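/- arXiv:1703.10665 — 9 statements merged into one kernel-verified Lean document; each statement's English description precedes it below -/
import Mathlib

section
/- Let E ⊆ ℝ^N be compact and let f : E → ℝ satisfy: for every ε > 0 there exists δ > 0 such that |f(x) − f(y)| ≤ ε‖x − y‖ for every pair of points x, y ∈ E with ‖x − y‖ < δ. Then there exists a C¹ function f̃ : ℝ^N → ℝ such that f̃(x) = f(x) for every x ∈ E and the (Fréchet) derivative of f̃ vanishes at every point of E. -/
open MeasureTheory Set Filter

noncomputable section

open Metric Topology

/-- A little-o Lipschitz function on a set is continuous there. -/
theorem continuousOn_of_littleO_lipschitz {V : Type*} [NormedAddCommGroup V]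
    {K : Set V} {f : V → ℝ}
    (hf : ∀ ε > (0:ℝ), ∃ δ > (0:ℝ), ∀ x ∈ K, ∀ y ∈ K, ‖x - y‖ < δ →
      |f x - f y| ≤ ε * ‖x - y‖) :
    ContinuousOn f K := by
  obtain ⟨δ, hδ, h⟩ := hf 1 one_pos
  refine Metric.continuousOn_iff.2 fun x hx ε hε => ⟨min δ ε, lt_min hδ hε, fun y hy hyx => ?_⟩
  rw [dist_eq_norm] at hyx
  rw [Real.dist_eq]
  have := h y hy x hx (hyx.trans_le (min_le_left _ _))
  linarith [hyx.trans_le (min_le_right _ _)]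

/-- A function which is little-o Lipschitz on a compact set admits a modulus `t * θ t` with `θ`
monotone, `θ t / t` antitone and `θ t → 0`. -/
theorem IsCompact.exists_modulus_of_littleO_lipschitz {V : Type*} [NormedAddCommGroup V]
    {K : Set V} (hK : IsCompact K) {f : V → ℝ}
    (hf : ∀ ε > (0:ℝ), ∃ δ > (0:ℝ), ∀ x ∈ K, ∀ y ∈ K, ‖x - y‖ < δ →
      |f x - f y| ≤ ε * ‖x - y‖) :
    ∃ θ : ℝ → ℝ, (∀ t, 0 ≤ t → t ≤ θ t) ∧ (∀ s t, 0 ≤ s → s ≤ t → θ s ≤ θ t) ∧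
      (∀ s t, 0 ≤ s → s ≤ t → s * θ t ≤ t * θ s) ∧
      (∀ ε > 0, ∃ δ > 0, θ δ ≤ ε) ∧
      ∀ x ∈ K, ∀ y ∈ K, |f x - f y| ≤ ‖x - y‖ * θ ‖x - y‖ := by
  obtain ⟨C, hC⟩ := hK.exists_bound_of_continuousOn (continuousOn_of_littleO_lipschitz hf)
  have hM : ∀ ε : Ioi (0:ℝ), ∃ M : ℝ, 1 ≤ M ∧ ∀ x ∈ K, ∀ y ∈ K,
      |f x - f y| ≤ ‖x - y‖ * (ε + M * ‖x - y‖) := by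
    rintro ⟨ε, hε⟩
    have hε' : 0 < ε := hε
    obtain ⟨δ, hδ, h⟩ := hf ε hε
    refine ⟨max 1 (2 * C / δ ^ 2), le_max_left _ _, fun x hx y hy => ?_⟩
    have hM1 := le_max_left 1 (2 * C / δ ^ 2)
    have hM2 := le_max_right 1 (2 * C / δ ^ 2)
    set M := max 1 (2 * C / δ ^ 2)
    have h0 := norm_nonneg (x - y)
    rcases lt_or_ge ‖x - y‖ δ with hlt | hge
    · have := h x hx y hy hlt
      have : 0 ≤ M * ‖x - y‖ ^ 2 := by positivity
      dsimp only
      nlinarith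
    · have h1 : |f x - f y| ≤ 2 * C := by
        have h2 := abs_sub (f x) (f y)
        have h3 := hC x hx
        have h4 := hC y hy
        rw [Real.norm_eq_abs] at h3 h4
        linarith
      rw [div_le_iff₀ (by positivity)] at hM2
      have h5 : M * δ ^ 2 ≤ M * ‖x - y‖ ^ 2 := by gcongr
      dsimp only
      nlinarith [mul_nonneg h0 hε'.le]
  choose M hM1 hM using hM
  have : Nonempty (Ioi (0:ℝ)) := ⟨⟨1, mem_Ioi.2 one_pos⟩⟩
  have hle : ∀ t, 0 ≤ t → ∀ ε : Ioi (0:ℝ), t ≤ ε + M ε * t := fun t ht ε => by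
    have : (0:ℝ) < ε := ε.2
    nlinarith [hM1 ε]
  have hbdd : ∀ t, 0 ≤ t → BddBelow (range fun ε : Ioi (0:ℝ) => (ε:ℝ) + M ε * t) :=
    fun t ht => ⟨t, by rintro _ ⟨ε, rfl⟩; exact hle t ht ε⟩
  refine ⟨fun t => ⨅ ε : Ioi (0:ℝ), ((ε:ℝ) + M ε * t), fun t ht => le_ciInf (hle t ht),
    fun s t hs hst => ?_, fun s t hs hst => ?_, fun ε hε => ?_, fun x hx y hy => ?_⟩
  · refine ciInf_mono (hbdd s hs) fun ε => ?_
    have := hM1 ε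
    gcongr
  · dsimp only
    rw [Real.mul_iInf_of_nonneg (hs.trans hst)]
    refine le_ciInf fun ε => ?_
    have h1 := mul_le_mul_of_nonneg_left (ciInf_le (hbdd t (hs.trans hst)) ε) hs
    have : (0:ℝ) < ε := ε.2
    nlinarith
  · have hM0 : 0 < M ⟨ε / 2, half_pos hε⟩ := one_pos.trans_le (hM1 _)
    refine ⟨ε / 2 / M ⟨ε / 2, half_pos hε⟩, by positivity, ?_⟩
    refine (ciInf_le (hbdd _ (by positivity)) ⟨ε / 2, half_pos hε⟩).trans_eq ?_
    field_simp
    ring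
  · rw [Real.mul_iInf_of_nonneg (norm_nonneg _)]
    exact le_ciInf fun ε => hM ε x hx y hy

/-- A little-o Lipschitz function on a nonempty compact set extends to a continuous function whose
Lipschitz constant near the set is arbitrarily small. -/
theorem IsCompact.exists_extension_of_littleO_lipschitz {V : Type*} [NormedAddCommGroup V]
    {K : Set V} (hK : IsCompact K) (hne : K.Nonempty) {f : V → ℝ}
    (hf : ∀ ε > (0:ℝ), ∃ δ > (0:ℝ), ∀ x ∈ K, ∀ y ∈ K, ‖x - y‖ < δ →
      |f x - f y| ≤ ε * ‖x - y‖) :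
    ∃ g : V → ℝ, Continuous g ∧ (∀ x ∈ K, g x = f x) ∧
      ∀ ε > 0, ∃ r > 0, ∀ p ∈ K, ∀ x ∈ ball p r, ∀ y ∈ ball p r,
        |g x - g y| ≤ ε * ‖x - y‖ := by
  obtain ⟨θ, hid, hmono, hdiv, hzero, hθ⟩ := hK.exists_modulus_of_littleO_lipschitz hf
  have hθ0 : ∀ t, 0 ≤ t → 0 ≤ θ t := fun t ht => ht.trans (hid t ht)
  have hstep : ∀ s t R, 0 ≤ s → s ≤ t → t ≤ R →
      |8 * (t * θ t) - 8 * (s * θ s)| ≤ 16 * θ R * (t - s) := by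
    intro s t R hs hst htR
    have ht := hs.trans hst
    have h1 : s * θ s ≤ t * θ t := mul_le_mul hst (hmono s t hs hst) (hθ0 s hs) ht
    rw [abs_of_nonneg (by linarith)]
    have h2 : θ t * (t - s) ≤ θ R * (t - s) :=
      mul_le_mul_of_nonneg_right (hmono t R ht htR) (by linarith)
    suffices t * θ t - s * θ s ≤ 2 * (θ t * (t - s)) by linarith
    rcases ht.eq_or_lt with h0 | h0
    · have : s = 0 := by linarith
      simp [← h0, this]
    · refine le_of_mul_le_mul_left ?_ h0
      have h3 := mul_le_mul_of_nonneg_left (hdiv s t hs hst) hs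
      nlinarith [mul_nonneg (hθ0 t ht) (sq_nonneg (t - s))]
  have hlip : ∀ s t R, 0 ≤ s → 0 ≤ t → s ≤ R → t ≤ R →
      |8 * (s * θ s) - 8 * (t * θ t)| ≤ 16 * θ R * |s - t| := by
    intro s t R hs ht hsR htR
    rcases le_total s t with h | h
    · rw [abs_sub_comm, abs_sub_comm s t, abs_of_nonneg (sub_nonneg.2 h)]
      exact hstep s t R hs h htR
    · rw [abs_of_nonneg (sub_nonneg.2 h)]
      exact hstep t s R ht h hsR
  have hmin : ∀ x, ∃ y ∈ K, ∀ z ∈ K,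
      f y + 8 * (‖x - y‖ * θ ‖x - y‖) ≤ f z + 8 * (‖x - z‖ * θ ‖x - z‖) := by
    intro x
    have hcont : ContinuousOn (fun y => f y + 8 * (‖x - y‖ * θ ‖x - y‖)) K := by
      refine (continuousOn_of_littleO_lipschitz hf).add ?_
      obtain ⟨R, hR⟩ := hK.exists_bound_of_continuousOn
        (f := fun y => x - y) (by fun_prop)
      have hΨ : ContinuousOn (fun t => 8 * (t * θ t)) (Icc 0 R) := by
        refine (LipschitzOnWith.of_dist_le_mul (K := (16 * θ R).toNNReal)
          fun s hs t ht => ?_).continuousOn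
        have hR0 := hθ0 R (hs.1.trans hs.2)
        rw [Real.coe_toNNReal _ (by positivity), Real.dist_eq, Real.dist_eq]
        exact hlip s t R hs.1 ht.1 hs.2 ht.2
      exact hΨ.comp (f := fun y => ‖x - y‖) (by fun_prop)
        fun y hy => ⟨norm_nonneg _, hR y hy⟩
    obtain ⟨y, hy, h⟩ := hK.exists_isMinOn hne hcont
    exact ⟨y, hy, fun z hz => h hz⟩
  choose y hyK hy using hmin
  have hclose : ∀ x, ∀ p ∈ K, ‖x - y x‖ ≤ 2 * ‖x - p‖ := by
    intro x p hp
    have hs := norm_nonneg (x - y x)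
    have hd := norm_nonneg (x - p)
    have h1 := hy x p hp
    have h2 := (le_abs_self _).trans (hθ p hp (y x) (hyK x))
    have htri : ‖p - y x‖ ≤ ‖x - y x‖ + ‖x - p‖ := by
      rw [show p - y x = (x - y x) - (x - p) by abel]
      exact norm_sub_le _ _
    set s := ‖x - y x‖
    set d := ‖x - p‖
    by_contra! hcon
    have hsd : d ≤ s := by linarith
    have h3 : ‖p - y x‖ * θ ‖p - y x‖ ≤ (2 * s) * θ (2 * s) :=
      mul_le_mul (by linarith) (hmono _ _ (norm_nonneg _) (by linarith))
        (hθ0 _ (norm_nonneg _)) (by linarith)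
    have h4 := hdiv s (2 * s) hs (by linarith)
    have h5 := hid s hs
    have h6 : 0 < s := by linarith
    have h7 : θ (2 * s) ≤ 2 * θ s := by
      refine le_of_mul_le_mul_left ?_ h6
      linarith
    have h8 : s * θ s ≤ 2 * d * θ d := by nlinarith
    have h9 := mul_le_mul_of_nonneg_left (hmono d s hd hsd) hd
    nlinarith
  set g : V → ℝ := fun x => f (y x) + 8 * (‖x - y x‖ * θ ‖x - y x‖) with hg
  have hball' : ∀ p ∈ K, ∀ r, ∀ x ∈ ball p r, ∀ z ∈ ball p r,
      g z - g x ≤ 16 * θ (4 * r) * ‖x - z‖ := by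
    intro p hp r x hx z hz
    rw [mem_ball, dist_eq_norm] at hx hz
    have h1 := hy z (y x) (hyK x)
    have h2 := hclose x p hp
    have h3 : ‖z - y x‖ ≤ ‖z - p‖ + ‖x - p‖ + ‖x - y x‖ := by
      rw [show z - y x = (z - p) - (x - p) + (x - y x) by abel]
      exact (norm_add_le _ _).trans (by gcongr; exact norm_sub_le _ _)
    have hr : 0 < r := (norm_nonneg _).trans_lt hx
    have h4 := (le_abs_self _).trans (hlip ‖z - y x‖ ‖x - y x‖ (4 * r) (norm_nonneg _)
      (norm_nonneg _) (by linarith) (by linarith))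
    have h5 : |‖z - y x‖ - ‖x - y x‖| ≤ ‖x - z‖ := by
      have := abs_norm_sub_norm_le (z - y x) (x - y x)
      rwa [sub_sub_sub_cancel_right, norm_sub_rev z x] at this
    have h6 := mul_le_mul_of_nonneg_left h5 (hθ0 (4 * r) (by positivity))
    simp only [hg]
    linarith
  have hball : ∀ p ∈ K, ∀ r, ∀ x ∈ ball p r, ∀ z ∈ ball p r,
      |g x - g z| ≤ 16 * θ (4 * r) * ‖x - z‖ := by
    intro p hp r x hx z hz
    refine abs_le.2 ⟨?_, ?_⟩
    · linarith [hball' p hp r x hx z hz]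
    · rw [norm_sub_rev]
      exact hball' p hp r z hz x hx
  refine ⟨g, ?_, fun x hx => ?_, fun ε hε => ?_⟩
  · obtain ⟨p, hp⟩ := hne
    refine continuous_iff_continuousAt.2 fun x => ?_
    have hcont : ContinuousOn g (ball p (‖x - p‖ + 1)) := by
      refine (LipschitzOnWith.of_dist_le_mul (K := (16 * θ (4 * (‖x - p‖ + 1))).toNNReal)
        fun s hs t ht => ?_).continuousOn
      have := hθ0 (4 * (‖x - p‖ + 1)) (by positivity)
      rw [Real.coe_toNNReal _ (by positivity), Real.dist_eq, dist_eq_norm]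
      exact hball p hp _ s hs t ht
    exact hcont.continuousAt (isOpen_ball.mem_nhds (by simp [dist_eq_norm]))
  · have h1 := hy x x hx
    have h2 := (le_abs_self _).trans (hθ x hx (y x) (hyK x))
    have h3 := mul_nonneg (norm_nonneg (x - y x)) (hθ0 _ (norm_nonneg (x - y x)))
    simp only [sub_self, norm_zero, zero_mul, mul_zero, add_zero] at h1
    simp only [hg]
    linarith
  · obtain ⟨δ, hδ, h⟩ := hzero (ε / 16) (by positivity)
    refine ⟨δ / 4, by positivity, fun p hp x hx z hz => (hball p hp _ x hx z hz).trans ?_⟩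
    rw [show 4 * (δ / 4) = δ by ring]
    gcongr
    linarith

/-- Smoothing at scale `h` of a continuous function keeps the local Lipschitz constants. -/
theorem exists_contDiff_norm_fderiv_le_of_continuous {V : Type*} [NormedAddCommGroup V]
    [NormedSpace ℝ V] [FiniteDimensional ℝ V] {g : V → ℝ} (hg : Continuous g) {h : ℝ}
    (hh : 0 < h) :
    ∃ S : V → ℝ, ContDiff ℝ 1 S ∧ ∀ ε ≥ 0, ∀ r > h, ∀ x,
      (∀ y ∈ ball x r, ∀ z ∈ ball x r, |g y - g z| ≤ ε * ‖y - z‖) →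
      |S x - g x| ≤ ε * h ∧ ‖fderiv ℝ S x‖ ≤ ε := by
  borelize V
  let μ : Measure V := Measure.addHaar
  let φ : ContDiffBump (0 : V) := ⟨h / 2, h, half_pos hh, half_lt_self hh⟩
  let L := ContinuousLinearMap.lsmul ℝ ℝ (E := ℝ)
  have hconv : ∀ u : V → ℝ, Continuous u → ConvolutionExists (φ.normed μ) u L μ := fun u hu =>
    φ.hasCompactSupport_normed.convolutionExists_left L φ.continuous_normed hu.locallyIntegrable
  refine ⟨convolution (φ.normed μ) g L μ, ?_, fun ε hε r hr x hx => ⟨?_, ?_⟩⟩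
  · exact φ.hasCompactSupport_normed.contDiff_convolution_left L (n := 1) φ.contDiff_normed
      hg.locallyIntegrable
  · rw [← Real.dist_eq]
    refine φ.dist_normed_convolution_le hg.aestronglyMeasurable fun y hy => ?_
    have hy' : ‖y - x‖ < h := by rwa [← dist_eq_norm]
    rw [Real.dist_eq]
    refine (hx y (ball_subset_ball hr.le hy) x (mem_ball_self (hh.trans hr))).trans ?_
    gcongr
  · refine norm_fderiv_le_of_lip' ℝ hε ?_
    filter_upwards [ball_mem_nhds x (sub_pos.2 hr)] with z hz
    have hz' : ‖z - x‖ < r - h := by rwa [← dist_eq_norm]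
    have hu : Continuous fun w => g (w + (z - x)) := by fun_prop
    have hsub : convolution (φ.normed μ) g L μ z - convolution (φ.normed μ) g L μ x =
        convolution (φ.normed μ) (fun w => g (w + (z - x)) - g w) L μ x := by
      have h1 := (hconv _ hu x).integrable
      have h2 := (hconv _ hg x).integrable
      have h3 : (fun t => L (φ.normed μ t) (g (z - t))) =
          fun t => L (φ.normed μ t) (g (x - t + (z - x))) := by
        ext t
        congr 2
        abel
      simp only [convolution_def, map_sub]
      rw [integral_sub h1 h2, h3]
    rw [hsub, ← dist_zero_right]
    refine dist_convolution_le (by positivity) φ.support_normed_eq.subset φ.nonneg_normed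
      φ.integral_normed (hu.sub hg).aestronglyMeasurable fun w hw => ?_
    have hw' : ‖w - x‖ < h := by rwa [← dist_eq_norm]
    rw [dist_zero_right, Real.norm_eq_abs]
    refine (hx _ ?_ _ (ball_subset_ball hr.le hw)).trans_eq ?_
    · rw [mem_ball, dist_eq_norm, add_sub_right_comm]
      exact (norm_add_le _ _).trans_lt (by linarith)
    · rw [add_sub_cancel_left]

/-- A `C¹` cutoff around a compact set with bounded derivative. -/
theorem IsCompact.exists_cutoff {V : Type*} [NormedAddCommGroup V]
    [NormedSpace ℝ V] [FiniteDimensional ℝ V] {K : Set V} (hK : IsCompact K) {r : ℝ}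
    (hr : 0 < r) :
    ∃ χ : V → ℝ, ∃ B : ℝ, 1 ≤ B ∧ ContDiff ℝ 1 χ ∧ (∀ x, |χ x| ≤ 1) ∧ (∀ x, ‖fderiv ℝ χ x‖ ≤ B) ∧
      (∀ x ∈ K, χ x = 1 ∧ fderiv ℝ χ x = 0) ∧
      ∀ x ∉ thickening r K, χ x = 0 ∧ fderiv ℝ χ x = 0 := by
  obtain ⟨χ, h1, h0, hχ⟩ := exists_contMDiffMap_one_nhds_of_subset_interior
    (n := 1) (modelWithCornersSelf ℝ V) (s := K) (t := thickening r K) hK.isClosed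
    (by rw [isOpen_thickening.interior_eq]; exact self_subset_thickening hr K)
  have hdiff : ContDiff ℝ 1 χ := χ.contMDiff.contDiff
  have hout : ∀ x ∉ thickening r K, χ x = 0 ∧ fderiv ℝ χ x = 0 := fun x hx =>
    ⟨h0 x hx, IsLocalMin.fderiv_eq_zero (Eventually.of_forall fun y => by
      rw [h0 x hx]; exact (hχ y).1)⟩
  have hin : ∀ x ∈ K, χ x = 1 ∧ fderiv ℝ χ x = 0 := fun x hx => by
    have hx1 := h1.self_of_nhdsSet x hx
    exact ⟨hx1, IsLocalMax.fderiv_eq_zero (Eventually.of_forall fun y => by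
      rw [hx1]; exact (hχ y).2)⟩
  obtain ⟨B, hB⟩ := (hK.cthickening (r := r)).exists_bound_of_continuousOn
    (hdiff.continuous_fderiv one_ne_zero).continuousOn
  refine ⟨χ, max 1 B, le_max_left _ _, hdiff, fun x => ?_, fun x => ?_, hin, hout⟩
  · rw [abs_of_nonneg (hχ x).1]
    exact (hχ x).2
  · by_cases hx : x ∈ thickening r K
    · exact (hB x (thickening_subset_cthickening r K hx)).trans (le_max_right _ _)
    · rw [(hout x hx).2, norm_zero]
      exact zero_le_one.trans (le_max_left _ _)

theorem tsum_sub_consecutive_of_tendsto {W : Type*} [NormedAddCommGroup W]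
    {u : ℕ → W} {a : W} (hs : Summable fun n => u (n + 1) - u n) (hu : Tendsto u atTop (𝓝 a)) :
    ∑' n, (u (n + 1) - u n) = a - u 0 := by
  refine tendsto_nhds_unique hs.hasSum.tendsto_sum_nat ?_
  simp only [Finset.sum_range_sub]
  exact hu.sub_const _

/-- Smooth approximations which are good at finitely many prescribed distances from a set. -/
theorem exists_contDiff_approx_near_of_locally_small_lipschitz {V : Type*}
    [NormedAddCommGroup V] [NormedSpace ℝ V] [FiniteDimensional ℝ V] {K : Set V}
    {g : V → ℝ} (hg : Continuous g) {e r B : ℕ → ℝ} (he0 : ∀ n, 0 < e n) (hr0 : ∀ n, 0 < r n)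
    (hB0 : ∀ n, 0 < B n)
    (hr : ∀ n, ∀ p ∈ K, ∀ x ∈ ball p (r n), ∀ y ∈ ball p (r n), |g x - g y| ≤ e n * ‖x - y‖)
    (n : ℕ) :
    ∃ S : V → ℝ, ContDiff ℝ 1 S ∧ ∀ j ≤ n, ∀ x ∈ thickening (r j / 2) K,
      |S x - g x| ≤ e j / B j ∧ ‖fderiv ℝ S x‖ ≤ e j := by
  obtain ⟨h, hh0, hh⟩ : ∃ h : ℝ, 0 < h ∧ ∀ j ≤ n, h < r j / 2 ∧ h ≤ 1 / B j := by
    have : ∀ᶠ h in 𝓝[>] (0:ℝ), ∀ j ∈ Finset.range (n + 1), h < r j / 2 ∧ h ≤ 1 / B j := by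
      rw [Filter.eventually_all_finset]
      intro j _
      have h1 := Ioo_mem_nhdsGT (half_pos (hr0 j))
      have h2 := Ioo_mem_nhdsGT (one_div_pos.2 (hB0 j))
      filter_upwards [h1, h2] with h h1 h2 using ⟨h1.2, h2.2.le⟩
    obtain ⟨h, h1, h2⟩ := (this.and self_mem_nhdsWithin).exists
    exact ⟨h, h2, fun j hj => h1 j (Finset.mem_range.2 (by omega))⟩
  obtain ⟨S, hS, hSlip⟩ := exists_contDiff_norm_fderiv_le_of_continuous hg hh0
  refine ⟨S, hS, fun j hj x hx => ?_⟩
  obtain ⟨p, hp, hxp⟩ := mem_thickening_iff.1 hx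
  have hsub : ball x (r j / 2) ⊆ ball p (r j) := ball_subset_ball' (by linarith)
  obtain ⟨h1, h2⟩ := hSlip (e j) (he0 j).le (r j / 2) (hh j hj).1 x
    fun y hy z hz => hr j p hp y (hsub hy) z (hsub hz)
  refine ⟨h1.trans ?_, h2⟩
  rw [div_eq_mul_one_div]
  exact mul_le_mul_of_nonneg_left (hh j hj).2 (he0 j).le

/-- Gluing of consecutive differences of a sequence of `C¹` functions. -/
theorem exists_contDiff_of_consecutive_differences {V W : Type*}
    [NormedAddCommGroup V] [NormedSpace ℝ V] [NormedAddCommGroup W] [NormedSpace ℝ W]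
    [CompleteSpace W] {K : Set V} {S D : ℕ → V → W} {u : ℕ → ℝ} {g : V → W} {g' : V → V →L[ℝ] W}
    (hu : Summable u) (hS : ∀ n, ContDiff ℝ 1 (S n)) (hD : ∀ n, ContDiff ℝ 1 (D n))
    (hDv : ∀ n x, ‖D n x‖ ≤ u n) (hDf : ∀ n x, ‖fderiv ℝ (D n) x‖ ≤ u n)
    (hDx : ∀ n, ∀ x ∈ K, D n x = S (n + 1) x - S n x)
    (hDfx : ∀ n, ∀ x ∈ K, fderiv ℝ (D n) x = fderiv ℝ (S (n + 1)) x - fderiv ℝ (S n) x)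
    (hlim : ∀ x ∈ K, Tendsto (fun n => S n x) atTop (𝓝 (g x)))
    (hlim' : ∀ x ∈ K, Tendsto (fun n => fderiv ℝ (S n) x) atTop (𝓝 (g' x))) :
    ∃ F : V → W, ContDiff ℝ 1 F ∧ ∀ x ∈ K, F x = g x ∧ fderiv ℝ F x = g' x := by
  have hFd : ContDiff ℝ 1 fun x => ∑' n, D n x := by
    refine contDiff_tsum (N := 1) (v := fun _ n => u n) hD (fun _ _ => hu) ?_
    intro k n x hk
    have hk1 : k ≤ 1 := by exact_mod_cast hk
    interval_cases k
    · rw [norm_iteratedFDeriv_zero]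
      exact hDv n x
    · rw [norm_iteratedFDeriv_one]
      exact hDf n x
  refine ⟨fun x => S 0 x + ∑' n, D n x, (hS 0).add hFd, fun x hx => ?_⟩
  have hDs : Summable fun n => D n x := Summable.of_norm_bounded hu fun n => hDv n x
  have hDfs : Summable fun n => fderiv ℝ (D n) x := Summable.of_norm_bounded hu fun n => hDf n x
  have hfd := fderiv_tsum_apply hu (fun n => (hD n).differentiable one_ne_zero) hDf hDs x
  simp only [fun n => hDx n x hx, fun n => hDfx n x hx] at hDs hDfs hfd
  constructor
  · simp only [fun n => hDx n x hx]
    rw [tsum_sub_consecutive_of_tendsto (u := fun n => S n x) hDs (hlim x hx), add_sub_cancel]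
  · rw [tsum_sub_consecutive_of_tendsto (u := fun n => fderiv ℝ (S n) x) hDfs (hlim' x hx)] at hfd
    rw [fderiv_fun_add ((hS 0).differentiable one_ne_zero x)
      (hFd.differentiable one_ne_zero x), hfd, add_sub_cancel]

/-- A function with arbitrarily small local Lipschitz constants near a compact set agrees on the set
with a `C¹` function whose derivative vanishes there. -/
theorem exists_contDiff_fderiv_eq_zero_of_locally_small_lipschitz {V : Type*}
    [NormedAddCommGroup V] [NormedSpace ℝ V] [FiniteDimensional ℝ V] {K : Set V}
    (hK : IsCompact K) {g : V → ℝ} (hg : Continuous g)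
    (hlip : ∀ ε > 0, ∃ r > 0, ∀ p ∈ K, ∀ x ∈ ball p r, ∀ y ∈ ball p r,
        |g x - g y| ≤ ε * ‖x - y‖) :
    ∃ F : V → ℝ, ContDiff ℝ 1 F ∧ ∀ x ∈ K, F x = g x ∧ fderiv ℝ F x = 0 := by
  set e : ℕ → ℝ := fun n => (1 / 2) ^ n with he
  have he0 : ∀ n, 0 < e n := fun n => by positivity
  choose r hr0 hr using fun n => hlip (e n) (he0 n)
  choose χ B hB hχ hχ1 hχB hχK hχout using fun n => hK.exists_cutoff (half_pos (hr0 n))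
  have hB0 : ∀ n, 0 < B n := fun n => one_pos.trans_le (hB n)
  choose S hSd hSb using exists_contDiff_approx_near_of_locally_small_lipschitz hg he0 hr0 hB0 hr
  set D : ℕ → V → ℝ := fun n x => χ n x * (S (n + 1) x - S n x) with hD
  have hSdiff : ∀ n x, DifferentiableAt ℝ (S n) x := fun n x =>
    (hSd n).differentiable one_ne_zero x
  have hfD : ∀ n x, fderiv ℝ (D n) x = χ n x • (fderiv ℝ (S (n + 1)) x - fderiv ℝ (S n) x) +
      (S (n + 1) x - S n x) • fderiv ℝ (χ n) x := fun n x => by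
    have h1 := ((hχ n).differentiable one_ne_zero x).hasFDerivAt.mul
      ((hSdiff (n + 1) x).hasFDerivAt.sub (hSdiff n x).hasFDerivAt)
    exact h1.fderiv
  have hdist : ∀ n, ∀ x ∈ thickening (r n / 2) K, |S (n + 1) x - S n x| ≤ 2 * (e n / B n) := by
    intro n x hx
    have h1 := (hSb (n + 1) n (Nat.le_succ n) x hx).1
    have h2 := (hSb n n le_rfl x hx).1
    rw [abs_le] at *
    constructor <;> linarith
  have hDv : ∀ n x, ‖D n x‖ ≤ 4 * e n := by
    intro n x
    have hen := he0 n
    by_cases hx : x ∈ thickening (r n / 2) K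
    · have h1 := hdist n x hx
      have h2 : e n / B n ≤ e n := div_le_self hen.le (hB n)
      rw [Real.norm_eq_abs, abs_mul]
      have := mul_le_mul (hχ1 n x) h1 (abs_nonneg _) zero_le_one
      linarith
    · simp only [hD, (hχout n x hx).1, zero_mul, norm_zero]
      positivity
  have hDf : ∀ n x, ‖fderiv ℝ (D n) x‖ ≤ 4 * e n := by
    intro n x
    have hen := he0 n
    rw [hfD]
    by_cases hx : x ∈ thickening (r n / 2) K
    · have h1 := hdist n x hx
      have h2 := norm_sub_le (fderiv ℝ (S (n + 1)) x) (fderiv ℝ (S n) x)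
      have h3 := (hSb (n + 1) n (Nat.le_succ n) x hx).2
      have h4 := (hSb n n le_rfl x hx).2
      refine (norm_add_le _ _).trans ?_
      rw [norm_smul, norm_smul, Real.norm_eq_abs, Real.norm_eq_abs]
      have h5 := mul_le_mul (hχ1 n x) (h2.trans (add_le_add h3 h4)) (norm_nonneg _) zero_le_one
      have h6 := mul_le_mul h1 (hχB n x) (norm_nonneg _)
        (by have := hB0 n; positivity)
      have h7 : 2 * (e n / B n) * B n = 2 * e n := by
        have := (hB0 n).ne'
        field_simp
      linarith
    · rw [(hχout n x hx).1, (hχout n x hx).2, zero_smul, smul_zero, add_zero, norm_zero]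
      positivity
  have hezero : Tendsto e atTop (𝓝 0) :=
    tendsto_pow_atTop_nhds_zero_of_lt_one (by norm_num) (by norm_num)
  have hxt : ∀ n, ∀ x ∈ K, x ∈ thickening (r n / 2) K := fun n x hx =>
    self_subset_thickening (half_pos (hr0 n)) K hx
  refine exists_contDiff_of_consecutive_differences (S := S) (D := D) (u := fun n => 4 * e n)
    (g' := fun _ => 0) (summable_geometric_two.mul_left 4) hSd
    (fun n => (hχ n).mul ((hSd (n + 1)).sub (hSd n))) hDv hDf (fun n x hx => ?_) (fun n x hx => ?_)
    (fun x hx => ?_) (fun x hx => ?_)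
  · simp only [hD, (hχK n x hx).1, one_mul]
  · rw [hfD, (hχK n x hx).1, (hχK n x hx).2, one_smul, smul_zero, add_zero]
  · refine tendsto_iff_norm_sub_tendsto_zero.2 (squeeze_zero (fun _ => norm_nonneg _)
      (fun n => ?_) hezero)
    exact (hSb n n le_rfl x (hxt n x hx)).1.trans (div_le_self (he0 n).le (hB n))
  · exact squeeze_zero_norm (fun n => (hSb n n le_rfl x (hxt n x hx)).2) hezero

theorem stmt1
    (N : ℕ) (hN : 1 ≤ N) (EE : Set (EuclideanSpace ℝ (Fin N))) (hE : IsCompact EE)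
    (f : EuclideanSpace ℝ (Fin N) → ℝ)
    (hf : ∀ ε > (0:ℝ), ∃ δ > (0:ℝ), ∀ x ∈ EE, ∀ y ∈ EE, ‖x - y‖ < δ →
      |f x - f y| ≤ ε * ‖x - y‖) :
    ∃ F : EuclideanSpace ℝ (Fin N) → ℝ, ContDiff ℝ 1 F ∧ (∀ x ∈ EE, F x = f x) ∧
      ∀ x ∈ EE, fderiv ℝ F x = 0 := by
  rcases EE.eq_empty_or_nonempty with rfl | hne
  · exact ⟨fun _ => 0, contDiff_const, by simp, by simp⟩
  obtain ⟨g, hg, hgf, hlip⟩ := hE.exists_extension_of_littleO_lipschitz hne hf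
  obtain ⟨F, hF, hFK⟩ := exists_contDiff_fderiv_eq_zero_of_locally_small_lipschitz hE hg hlip
  exact ⟨F, hF, fun x hx => (hFK x hx).1.trans (hgf x hx), fun x hx => (hFK x hx).2⟩
end
end

section
/- There exists a homeomorphism g from [0,1] onto Λ such that for every integer k ≥ 1 there is an injective assignment of a word (w₁(j),…,w_k(j)) ∈ {1,…,ℓ}^k to each j ∈ {1,…,ℓ^k} satisfying g([(j−1)/ℓ^k, j/ℓ^k]) = S_{w₁(j)} ∘ ⋯ ∘ S_{w_k(j)}(Λ) for every j ∈ {1,…,ℓ^k}. -/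
open MeasureTheory Set Filter

noncomputable section

/-- A continuous strictly increasing self-map of the unit interval has a continuous monotone left
inverse which is constant below and above the range. -/
lemma exists_monotone_leftInverse {F : unitInterval → unitInterval} (hF : StrictMono F)
    (hc : Continuous F) :
    ∃ u : unitInterval → unitInterval, Continuous u ∧ Monotone u ∧ (∀ x, u (F x) = x) ∧
      (∀ x, x ≤ F 0 → u x = 0) ∧ ∀ x, F 1 ≤ x → u x = 1 := by
  have h01 : F 0 ≤ F 1 := hF.monotone unitInterval.nonneg'
  have hex : ∀ x, ∃ y, F y = max (F 0) (min (F 1) x) := fun x => by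
    have := intermediate_value_Icc (a := (0 : unitInterval)) (b := 1) unitInterval.nonneg'
      hc.continuousOn
    obtain ⟨y, -, hy⟩ := this (show max (F 0) (min (F 1) x) ∈ Icc (F 0) (F 1) from
      ⟨le_max_left _ _, max_le h01 (min_le_left _ _)⟩)
    exact ⟨y, hy⟩
  choose u hu using hex
  have hleft : ∀ x, u (F x) = x := fun x => hF.injective (by
    rw [hu, min_eq_right (hF.monotone unitInterval.le_one'),
      max_eq_right (hF.monotone unitInterval.nonneg')])
  have hmono : Monotone u := fun x y hxy => hF.le_iff_le.1 (by
    rw [hu, hu]; gcongr)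
  refine ⟨u, hmono.continuous_of_surjective fun x => ⟨F x, hleft x⟩, hmono, hleft,
    fun x hx => hF.injective ?_, fun x hx => hF.injective ?_⟩
  · rw [hu, min_eq_right (hx.trans h01), max_eq_left hx]
  · rw [hu, min_eq_left hx, max_eq_right h01]

/-- Reverse the unit interval (in the real line) if `b` holds. -/
def flipReal (b : Bool) (y : ℝ) : ℝ := if b then 1 - y else y

/-- Reverse the unit interval if `b` holds. -/
def flipUnit (b : Bool) (x : unitInterval) : unitInterval := if b then unitInterval.symm x else x

lemma continuous_flipUnit (b : Bool) : Continuous (flipUnit b) := by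
  cases b
  · exact continuous_id
  · exact unitInterval.continuous_symm

lemma continuous_flipReal (b : Bool) : Continuous (flipReal b) := by
  cases b
  · exact continuous_id
  · exact continuous_const.sub continuous_id

lemma flipUnit_flipUnit (b : Bool) (x : unitInterval) : flipUnit b (flipUnit b x) = x := by
  cases b <;> simp [flipUnit]

lemma flipReal_flipReal (b : Bool) (x : ℝ) : flipReal b (flipReal b x) = x := by
  cases b <;> simp [flipReal]

lemma abs_flipReal_sub (b : Bool) (x y : ℝ) : |flipReal b x - flipReal b y| = |x - y| := by
  cases b
  · simp [flipReal]
  · simp [flipReal, abs_sub_comm]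

lemma monotone_flip {ψ : unitInterval → ℝ} (hψ : Monotone ψ) (b : Bool) :
    Monotone fun x => flipReal b (ψ (flipUnit b x)) := by
  cases b
  · exact hψ
  · intro x y hxy
    have : unitInterval.symm y ≤ unitInterval.symm x := by simpa using hxy
    exact sub_le_sub_left (hψ this) 1

lemma flip_zero {ψ : unitInterval → ℝ} (h0 : ψ 0 = 0) (h1 : ψ 1 = 1) (b : Bool) :
    flipReal b (ψ (flipUnit b 0)) = 0 := by
  cases b <;> simp [flipReal, flipUnit, h0, h1]

lemma flip_one {ψ : unitInterval → ℝ} (h0 : ψ 0 = 0) (h1 : ψ 1 = 1) (b : Bool) :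
    flipReal b (ψ (flipUnit b 1)) = 1 := by
  cases b <;> simp [flipReal, flipUnit, h0, h1]

lemma sum_range_step {ℓ i : ℕ} (hi : i < ℓ) {c : ℕ → ℝ} (h1 : ∀ j < i, c j = 1)
    (h0 : ∀ j, i < j → j < ℓ → c j = 0) : ∑ j ∈ Finset.range ℓ, c j = i + c i := by
  rw [← Finset.sum_subset (Finset.range_subset_range.2 hi)
    (fun j hj hj' => h0 j (by simp at hj'; omega) (by simpa using hj)), Finset.sum_range_succ,
    Finset.sum_congr rfl (fun j hj => h1 j (by simpa using hj))]
  simp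

/-- The semiconjugacy from a system of increasing maps with ordered ranges covering the unit
interval to the `ℓ`-adic system with prescribed orientations. -/
lemma exists_semiconj {ℓ : ℕ} (hℓ : 2 ≤ ℓ) {F : ℕ → unitInterval → unitInterval} (b : ℕ → Bool)
    (hF : ∀ i < ℓ, StrictMono (F i)) (hc : ∀ i < ℓ, Continuous (F i))
    (hcov : ∀ x, ∃ i < ℓ, ∃ y, F i y = x) (hord : ∀ i < ℓ, ∀ j < i, F j 1 ≤ F i 0) :
    ∃ ψ : unitInterval → ℝ, Monotone ψ ∧ Continuous ψ ∧ ψ 0 = 0 ∧ ψ 1 = 1 ∧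
      ∀ i < ℓ, ∀ x, ψ (F i x) = (i + flipReal (b i) (ψ (flipUnit (b i) x))) / ℓ := by
  have hℓ0 : (0 : ℝ) < ℓ := by exact_mod_cast (by omega : 0 < ℓ)
  have hu : ∀ i, ∃ u : unitInterval → unitInterval, i < ℓ → Continuous u ∧ Monotone u ∧
      (∀ x, u (F i x) = x) ∧ (∀ x, x ≤ F i 0 → u x = 0) ∧ ∀ x, F i 1 ≤ x → u x = 1 := fun i => by
    by_cases hi : i < ℓ
    · obtain ⟨u, hu⟩ := exists_monotone_leftInverse (hF i hi) (hc i hi)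
      exact ⟨u, fun _ => hu⟩
    · exact ⟨id, fun h => absurd h hi⟩
  choose u hu using hu
  let X : Set C(unitInterval, ℝ) := {ψ | Monotone ψ ∧ ψ 0 = 0 ∧ ψ 1 = 1}
  have hX : IsClosed X := by
    have h1 : IsClosed {ψ : C(unitInterval, ℝ) | Monotone ψ} := by
      simp only [Monotone, ofPred_forall]
      refine isClosed_iInter fun x => isClosed_iInter fun y => isClosed_iInter fun _ =>
        isClosed_le (continuous_eval_const x) (continuous_eval_const y)
    exact h1.inter ((isClosed_eq (continuous_eval_const 0) continuous_const).inter
      (isClosed_eq (continuous_eval_const 1) continuous_const))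
  have : CompleteSpace X := hX.completeSpace_coe
  have : Nonempty X := ⟨⟨⟨Subtype.val, continuous_subtype_val⟩, fun _ _ h => h, rfl, rfl⟩⟩
  let v : C(unitInterval, ℝ) → ℕ → unitInterval → ℝ :=
    fun ψ i x => flipReal (b i) (ψ (flipUnit (b i) (u i x)))
  have hvc : ∀ ψ, ∀ i < ℓ, Continuous (v ψ i) := fun ψ i hi =>
    (continuous_flipReal _).comp
      (ψ.continuous.comp ((continuous_flipUnit _).comp (hu i hi).1))
  let Φ : X → X := fun ψ => ⟨⟨fun x => (∑ i ∈ Finset.range ℓ, v ψ i x) / ℓ,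
      (continuous_finsetSum _ fun i hi => hvc ψ i (by simpa using hi)).div_const _⟩, by
    refine ⟨fun x y hxy => ?_, ?_, ?_⟩
    · refine div_le_div_of_nonneg_right (Finset.sum_le_sum fun i hi => ?_) hℓ0.le
      exact monotone_flip ψ.2.1 (b i) ((hu i (by simpa using hi)).2.1 hxy)
    · have : ∀ i ∈ Finset.range ℓ, v ψ i 0 = 0 := fun i hi => by
        simp only [v]
        rw [(hu i (by simpa using hi)).2.2.2.1 _ unitInterval.nonneg', flip_zero ψ.2.2.1 ψ.2.2.2]
      simp [Finset.sum_congr rfl this]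
    · have : ∀ i ∈ Finset.range ℓ, v ψ i 1 = 1 := fun i hi => by
        simp only [v]
        rw [(hu i (by simpa using hi)).2.2.2.2 _ unitInterval.le_one', flip_one ψ.2.2.1 ψ.2.2.2]
      simp [Finset.sum_congr rfl this, hℓ0.ne']⟩
  have hΦ : ∀ ψ : X, ∀ i < ℓ, ∀ x,
      (Φ ψ).1 (F i x) = (i + flipReal (b i) (ψ.1 (flipUnit (b i) x))) / ℓ := fun ψ i hi x => by
    change (∑ j ∈ Finset.range ℓ, v ψ j (F i x)) / ℓ = _
    rw [sum_range_step hi]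
    · simp only [v]
      rw [(hu i hi).2.2.1]
    · intro j hj
      simp only [v]
      rw [(hu j (hj.trans hi)).2.2.2.2 _
        ((hord i hi j hj).trans ((hF i hi).monotone unitInterval.nonneg')),
        flip_one ψ.2.2.1 ψ.2.2.2]
    · intro j hj hjl
      simp only [v]
      rw [(hu j hjl).2.2.2.1 _
        (((hF i hi).monotone unitInterval.le_one').trans (hord j hjl i hj)),
        flip_zero ψ.2.2.1 ψ.2.2.2]
  have hcontr : ContractingWith (ℓ : NNReal)⁻¹ Φ := by
    refine ⟨inv_lt_one_of_one_lt₀ (by exact_mod_cast hℓ), LipschitzWith.of_dist_le_mul ?_⟩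
    intro ψ ψ'
    rw [Subtype.dist_eq, ContinuousMap.dist_le (by positivity)]
    intro x
    obtain ⟨i, hi, y, rfl⟩ := hcov x
    rw [hΦ _ i hi, hΦ _ i hi, Real.dist_eq, ← sub_div, add_sub_add_left_eq_sub, abs_div,
      abs_flipReal_sub, abs_of_pos hℓ0, div_eq_inv_mul, ← Real.dist_eq]
    simp only [NNReal.coe_inv, NNReal.coe_natCast]
    exact mul_le_mul_of_nonneg_left (ContinuousMap.dist_apply_le_dist _) (by positivity)
  obtain ⟨ψ, hψ⟩ : ∃ ψ, Φ ψ = ψ := ⟨_, hcontr.fixedPoint_isFixedPt⟩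
  refine ⟨ψ.1, ψ.2.1, ψ.1.continuous, ψ.2.2.1, ψ.2.2.2, fun i hi x => ?_⟩
  rw [← hΦ ψ i hi x, hψ]

/-- Composition of the maps `f i` along a word. -/
def wordMap {α : Type*} (f : ℕ → α → α) (w : List ℕ) : α → α := (w.map f).foldr (· ∘ ·) id

lemma wordMap_cons {α : Type*} (f : ℕ → α → α) (i : ℕ) (w : List ℕ) (x : α) :
    wordMap f (i :: w) x = f i (wordMap f w x) := rfl

/-- A system of injective maps of the unit interval with ordered ranges and shrinking cylinders is
conjugate to an `ℓ`-adic system. -/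
lemma exists_conj {ℓ : ℕ} (hℓ : 2 ≤ ℓ) {f : ℕ → unitInterval → unitInterval}
    (hc : ∀ i < ℓ, Continuous (f i)) (hinj : ∀ i < ℓ, Function.Injective (f i))
    (hcov : ∀ x, ∃ i < ℓ, ∃ y, f i y = x) (hord : ∀ i < ℓ, ∀ j < i, ∀ x y, f j x ≤ f i y)
    (hcell : ∀ s t, s < t → ∃ w : List ℕ, (∀ i ∈ w, i < ℓ) ∧ ∀ x, wordMap f w x ∈ Icc s t) :
    ∃ (φ : unitInterval ≃ₜ unitInterval) (b : ℕ → Bool), ∀ i < ℓ, ∀ x,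
      (φ (f i x) : ℝ) = (i + flipReal (b i) (φ x)) / ℓ := by
  have hℓ0 : (0 : ℝ) < ℓ := by exact_mod_cast (by omega : 0 < ℓ)
  have hb : ∀ i, ∃ b : Bool, i < ℓ → StrictMono fun x => f i (flipUnit b x) := fun i => by
    by_cases hi : i < ℓ
    · rcases (hc i hi).strictMono_of_inj_boundedOrder' (hinj i hi) with h | h
      · exact ⟨false, fun _ => h⟩
      · refine ⟨true, fun _ x y hxy => h ?_⟩
        simpa [flipUnit] using hxy
    · exact ⟨true, fun h => absurd h hi⟩
  choose b hb using hb
  obtain ⟨ψ, hm, hψc, h0, h1, hψ⟩ := exists_semiconj hℓ (F := fun i x => f i (flipUnit (b i) x)) b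
    hb (fun i hi => (hc i hi).comp (continuous_flipUnit _))
    (fun x => by
      obtain ⟨i, hi, y, rfl⟩ := hcov x
      exact ⟨i, hi, flipUnit (b i) y, by rw [flipUnit_flipUnit]⟩)
    (fun i hi j hj => hord i hi j hj _ _)
  have hψ' : ∀ i < ℓ, ∀ x, ψ (f i x) = (i + flipReal (b i) (ψ x)) / ℓ := fun i hi x => by
    simpa only [flipUnit_flipUnit] using hψ i hi (flipUnit (b i) x)
  have hword : ∀ w : List ℕ, (∀ i ∈ w, i < ℓ) → ∀ x y,
      ψ (wordMap f w x) = ψ (wordMap f w y) → ψ x = ψ y := by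
    intro w
    induction w with
    | nil => exact fun _ x y h => h
    | cons i w ih =>
      intro hw x y h
      rw [wordMap_cons, wordMap_cons, hψ' i (hw i (by simp)), hψ' i (hw i (by simp))] at h
      refine ih (fun j hj => hw j (by simp [hj])) x y ?_
      rw [div_left_inj' hℓ0.ne', add_right_inj] at h
      rw [← flipReal_flipReal (b i) (ψ (wordMap f w x)), h, flipReal_flipReal]
  have hsm : StrictMono ψ := hm.strictMono_of_injective <| by
    have key : ∀ s t, s < t → ψ s ≠ ψ t := fun s t hst he => by
      obtain ⟨w, hw, hx⟩ := hcell s t hst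
      have hconst : ∀ x, ψ (wordMap f w x) = ψ s := fun x =>
        le_antisymm ((hm (hx x).2).trans he.ge) (hm (hx x).1)
      have := hword w hw 0 1 ((hconst 0).trans (hconst 1).symm)
      rw [h0, h1] at this
      exact zero_ne_one this
    intro s t he
    rcases lt_trichotomy s t with h | h | h
    · exact absurd he (key s t h)
    · exact h
    · exact absurd he.symm (key t s h)
  let ψI : unitInterval → unitInterval := fun x =>
    ⟨ψ x, h0 ▸ hm unitInterval.nonneg', h1 ▸ hm unitInterval.le_one'⟩
  have hsurj : Function.Surjective ψI := fun y => by
    obtain ⟨x, -, hx⟩ := intermediate_value_Icc (a := (0 : unitInterval)) (b := 1)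
      unitInterval.nonneg' hψc.continuousOn (show (y : ℝ) ∈ Icc (ψ 0) (ψ 1) by
        rw [h0, h1]; exact y.2)
    exact ⟨x, Subtype.ext hx⟩
  have hsmI : StrictMono ψI := fun x y h => hsm h
  exact ⟨(hsmI.orderIsoOfSurjective ψI hsurj).toHomeomorph, b, hψ'⟩

/-- Arcs of the unit interval such that consecutive ones meet in a point and the other pairs are
disjoint are linearly ordered, either from left to right or from right to left. -/
lemma ordered_or_reversed {ℓ : ℕ} (hℓ : 2 ≤ ℓ) {f : ℕ → unitInterval → unitInterval}
    (hc : ∀ i < ℓ, Continuous (f i)) (hinj : ∀ i < ℓ, Function.Injective (f i))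
    (hadj : ∀ i, i + 1 < ℓ → ∃ p, range (f i) ∩ range (f (i + 1)) = {p})
    (hdisj : ∀ i j, i + 1 < j → j < ℓ → Disjoint (range (f i)) (range (f j))) :
    (∀ i < ℓ, ∀ j < i, ∀ x y, f j x ≤ f i y) ∨ ∀ i < ℓ, ∀ j < i, ∀ x y, f i x ≤ f j y := by
  have hIcc : ∀ i, ∃ a b : unitInterval, i < ℓ → a < b ∧ range (f i) = Icc a b := fun i => by
    by_cases hi : i < ℓ
    · have h := eq_Icc_of_connected_compact (isConnected_range (hc i hi))
        (isCompact_range (hc i hi))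
      refine ⟨_, _, fun _ => ⟨?_, h⟩⟩
      by_contra! hle
      have h01 : f i 0 = f i 1 := by
        have h0 : f i 0 ∈ range (f i) := mem_range_self _
        have h1 : f i 1 ∈ range (f i) := mem_range_self _
        rw [h] at h0 h1
        exact le_antisymm ((h0.2.trans hle).trans h1.1) ((h1.2.trans hle).trans h0.1)
      exact zero_ne_one (hinj i hi h01)
    · exact ⟨0, 0, fun h => absurd h hi⟩
  choose a b hab using hIcc
  have hPQ : ∀ i, i + 1 < ℓ → b i = a (i + 1) ∨ b (i + 1) = a i := fun i hi => by
    obtain ⟨p, hp⟩ := hadj i hi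
    have h1 := (hab i (by omega)).1
    have h2 := (hab (i + 1) hi).1
    rw [(hab i (by omega)).2, (hab (i + 1) hi).2, Icc_inter_Icc, Icc_eq_singleton_iff] at hp
    grind
  have hnot : ∀ i, i + 2 < ℓ → ∀ p, p ∈ Icc (a i) (b i) → p ∉ Icc (a (i + 2)) (b (i + 2)) :=
    fun i hi p hp hp' => by
      rw [← (hab i (by omega)).2] at hp
      rw [← (hab (i + 2) hi).2] at hp'
      exact disjoint_left.1 (hdisj i (i + 2) (by omega) hi) hp hp'
  have hmem : ∀ i < ℓ, ∀ x, f i x ∈ Icc (a i) (b i) := fun i hi x =>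
    (hab i hi).2 ▸ mem_range_self x
  rcases hPQ 0 (by omega) with h0 | h0
  · have hP : ∀ i, i + 1 < ℓ → b i = a (i + 1) := fun i => by
      induction i with
      | zero => exact fun _ => h0
      | succ i ih =>
        intro hi
        refine (hPQ (i + 1) hi).resolve_right fun h => ?_
        exact hnot i hi (b i) ⟨(hab i (by omega)).1.le, le_rfl⟩
          (by rw [ih (by omega), ← h]; exact ⟨(hab (i + 2) hi).1.le, le_rfl⟩)
    have hle : ∀ j i, j + 1 ≤ i → i < ℓ → b j ≤ a i := fun j i hji => by
      induction i, hji using Nat.le_induction with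
      | base => exact fun h => (hP j h).le
      | succ i hji ih =>
        intro hi
        exact ((ih (by omega)).trans (hab i (by omega)).1.le).trans (hP i hi).le
    exact Or.inl fun i hi j hj x y =>
      ((hmem j (by omega) x).2.trans (hle j i hj hi)).trans (hmem i hi y).1
  · have hQ : ∀ i, i + 1 < ℓ → b (i + 1) = a i := fun i => by
      induction i with
      | zero => exact fun _ => h0
      | succ i ih =>
        intro hi
        refine (hPQ (i + 1) hi).resolve_left fun h => ?_
        exact hnot i hi (a i) ⟨le_rfl, (hab i (by omega)).1.le⟩
          (by rw [← ih (by omega), h]; exact ⟨le_rfl, (hab (i + 2) hi).1.le⟩)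
    have hle : ∀ j i, j + 1 ≤ i → i < ℓ → b i ≤ a j := fun j i hji => by
      induction i, hji using Nat.le_induction with
      | base => exact fun h => (hQ j h).le
      | succ i hji ih =>
        intro hi
        exact ((hQ i hi).le.trans (hab i (by omega)).1.le).trans (ih (by omega))
    exact Or.inr fun i hi j hj x y =>
      ((hmem i hi x).2.trans (hle j i hj hi)).trans (hmem j (by omega) y).1

section Lift

variable {E : Type*} [MetricSpace E] {Λ : Set E}

lemma continuous_of_lift (h : unitInterval ≃ₜ Λ) {S : E → E} (hS : Continuous S)
    {f : unitInterval → unitInterval} (hf : ∀ x, (h (f x) : E) = S (h x)) : Continuous f := by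
  rw [← h.comp_continuous_iff, continuous_induced_rng]
  have : (Subtype.val ∘ (h ∘ f)) = fun x => S (h x) := funext hf
  rw [this]
  exact hS.comp (continuous_subtype_val.comp h.continuous)

lemma injective_of_lift (h : unitInterval ≃ₜ Λ) {S : E → E} (hS : Function.Injective S)
    {f : unitInterval → unitInterval} (hf : ∀ x, (h (f x) : E) = S (h x)) :
    Function.Injective f := fun x y hxy => by
  have := hf x
  rw [hxy, hf y] at this
  exact h.injective (Subtype.ext (hS this)).symm

lemma image_range_lift (h : unitInterval ≃ₜ Λ) {S : E → E}
    {f : unitInterval → unitInterval} (hf : ∀ x, (h (f x) : E) = S (h x)) :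
    (fun x => (h x : E)) '' range f = S '' Λ := by
  ext z
  constructor
  · rintro ⟨_, ⟨x, rfl⟩, rfl⟩
    exact ⟨h x, (h x).2, (hf x).symm⟩
  · rintro ⟨y, hy, rfl⟩
    exact ⟨_, ⟨h.symm ⟨y, hy⟩, rfl⟩, by simp [hf]⟩

/-- An arc which is the union of successively adjacent copies of itself has a parametrisation
along which the copies appear in increasing order. -/
lemma exists_ordered_lift {ℓ : ℕ} (hℓ : 2 ≤ ℓ) {S : ℕ → E → E} (h : unitInterval ≃ₜ Λ)
    (hc : ∀ i < ℓ, Continuous (S i)) (hinj : ∀ i < ℓ, Function.Injective (S i))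
    (hmaps : ∀ i < ℓ, ∀ x ∈ Λ, S i x ∈ Λ)
    (hadj : ∀ i, i + 1 < ℓ → ∃ p, S i '' Λ ∩ S (i + 1) '' Λ = {p})
    (hdisj : ∀ i j, i + 1 < j → j < ℓ → Disjoint (S i '' Λ) (S j '' Λ)) :
    ∃ (h : unitInterval ≃ₜ Λ) (f : ℕ → unitInterval → unitInterval),
      (∀ i < ℓ, ∀ x, (h (f i x) : E) = S i (h x)) ∧ ∀ i < ℓ, ∀ j < i, ∀ x y, f j x ≤ f i y := by
  have hex : ∀ i, ∃ f : unitInterval → unitInterval, i < ℓ → ∀ x, (h (f x) : E) = S i (h x) :=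
    fun i => by
      by_cases hi : i < ℓ
      · exact ⟨fun x => h.symm ⟨S i (h x), hmaps i hi _ (h x).2⟩, fun _ x => by simp⟩
      · exact ⟨id, fun h => absurd h hi⟩
  choose f hf using hex
  have hval : Function.Injective fun x => (h x : E) := Subtype.val_injective.comp h.injective
  rcases ordered_or_reversed hℓ (f := f) (fun i hi => continuous_of_lift h (hc i hi) (hf i hi))
    (fun i hi => injective_of_lift h (hinj i hi) (hf i hi))
    (fun i hi => by
      obtain ⟨p, hp⟩ := hadj i hi
      rw [← image_range_lift h (hf i (by omega)), ← image_range_lift h (hf _ hi),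
        ← image_inter hval] at hp
      obtain ⟨q, hq, hqp⟩ : p ∈ _ '' _ := hp ▸ mem_singleton p
      exact ⟨q, hval.image_injective (by rw [hp, image_singleton, ← hqp])⟩)
    (fun i j hij hj => by
      have := hdisj i j hij hj
      rw [← image_range_lift h (hf i (by omega)), ← image_range_lift h (hf _ hj)] at this
      exact this.of_image) with H | H
  · exact ⟨h, f, hf, H⟩
  · refine ⟨unitInterval.symmHomeomorph.trans h,
      fun i x => unitInterval.symm (f i (unitInterval.symm x)), fun i hi x => ?_,
      fun i hi j hj x y => ?_⟩
    · simp [hf i hi]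
    · simpa using H i hi j hj _ _

lemma exists_cell {ℓ : ℕ} {f : ℕ → unitInterval → unitInterval}
    (hcov : ∀ x, ∃ i < ℓ, ∃ y, f i y = x) (n : ℕ) (x : unitInterval) :
    ∃ w : List ℕ, w.length = n ∧ (∀ i ∈ w, i < ℓ) ∧ ∃ y, wordMap f w y = x := by
  induction n generalizing x with
  | zero => exact ⟨[], rfl, by simp, x, rfl⟩
  | succ n ih =>
    obtain ⟨i, hi, y, rfl⟩ := hcov x
    obtain ⟨w, hw, hwl, z, rfl⟩ := ih y
    exact ⟨i :: w, by simp [hw], by simpa using ⟨hi, hwl⟩, z, rfl⟩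

lemma dist_wordMap_le {ℓ : ℕ} {S : ℕ → E → E} {ρ : ℝ} (hρ : 0 ≤ ρ)
    (hS : ∀ i < ℓ, ∀ x y, dist (S i x) (S i y) ≤ ρ * dist x y) (h : unitInterval ≃ₜ Λ)
    {f : ℕ → unitInterval → unitInterval} (hf : ∀ i < ℓ, ∀ x, (h (f i x) : E) = S i (h x))
    (w : List ℕ) (hw : ∀ i ∈ w, i < ℓ) (x y : unitInterval) :
    dist (h (wordMap f w x)) (h (wordMap f w y)) ≤ ρ ^ w.length * dist (h x) (h y) := by
  induction w with
  | nil => simp [wordMap]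
  | cons i w ih =>
    have hi := hw i (by simp)
    rw [wordMap_cons, wordMap_cons, Subtype.dist_eq, hf i hi, hf i hi, List.length_cons, pow_succ',
      mul_assoc]
    exact (hS i hi _ _).trans
      (mul_le_mul_of_nonneg_left (ih fun j hj => hw j (by simp [hj])) hρ)

lemma exists_cell_subset_Icc {ℓ : ℕ} {S : ℕ → E → E} {ρ : ℝ} (hρ : 0 ≤ ρ) (hρ1 : ρ < 1)
    (hS : ∀ i < ℓ, ∀ x y, dist (S i x) (S i y) ≤ ρ * dist x y) (h : unitInterval ≃ₜ Λ)
    {f : ℕ → unitInterval → unitInterval} (hf : ∀ i < ℓ, ∀ x, (h (f i x) : E) = S i (h x))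
    (hcov : ∀ x, ∃ i < ℓ, ∃ y, f i y = x) (s t : unitInterval) (hst : s < t) :
    ∃ w : List ℕ, (∀ i ∈ w, i < ℓ) ∧ ∀ x, wordMap f w x ∈ Icc s t := by
  obtain ⟨m, hsm, hmt⟩ := exists_between hst
  have hnhds : h.symm ⁻¹' Ioo s t ∈ nhds (h m) :=
    h.symm.continuous.continuousAt.preimage_mem_nhds
      (by rw [h.symm_apply_apply]; exact Ioo_mem_nhds hsm hmt)
  obtain ⟨ε, hε, hball⟩ := Metric.mem_nhds_iff.1 hnhds
  obtain ⟨D, hD⟩ := (Metric.isBounded_range_iff).1 (isCompact_range h.continuous).isBounded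
  have hD0 : 0 ≤ D := dist_nonneg.trans (hD 0 0)
  obtain ⟨n, hn⟩ := exists_pow_lt_of_lt_one (div_pos hε (by linarith : 0 < D + 1)) hρ1
  obtain ⟨w, rfl, hw, y, hy⟩ := exists_cell hcov n m
  refine ⟨w, hw, fun x => ?_⟩
  have hx : h (wordMap f w x) ∈ Metric.ball (h m) ε := by
    rw [Metric.mem_ball, ← hy]
    rw [lt_div_iff₀ (by linarith)] at hn
    have hp : 0 ≤ ρ ^ w.length := pow_nonneg hρ _
    calc _ ≤ ρ ^ w.length * dist (h x) (h y) := dist_wordMap_le hρ hS h hf w hw x y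
      _ ≤ ρ ^ w.length * (D + 1) :=
        mul_le_mul_of_nonneg_left ((hD x y).trans (by linarith)) hp
      _ < ε := hn
  have := hball hx
  rw [mem_preimage, h.symm_apply_apply] at this
  exact Ioo_subset_Icc_self this

/-- A parametrisation conjugating `S` to an `ℓ`-adic system maps `ℓ`-adic intervals to
cylinders. -/
lemma exists_word_image_eq {ℓ : ℕ} (hℓ : 2 ≤ ℓ) {S : ℕ → E → E} (g : unitInterval ≃ₜ Λ)
    (b : ℕ → Bool) (hg : ∀ i < ℓ, ∀ t t' : unitInterval,
      (t' : ℝ) = (i + flipReal (b i) t) / ℓ → (g t' : E) = S i (g t)) (k j : ℕ) (hj : j < ℓ ^ k) :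
    ∃ w : Fin k → ℕ, (∀ i, w i < ℓ) ∧
      (fun t => (g t : E)) '' {t | (j : ℝ) / (ℓ : ℝ) ^ k ≤ t ∧ (t : ℝ) ≤ (j + 1) / (ℓ : ℝ) ^ k} =
        ((List.ofFn fun i => S (w i)).foldr (· ∘ ·) id) '' Λ := by
  have hℓ0 : (0 : ℝ) < ℓ := by exact_mod_cast (by omega : 0 < ℓ)
  induction k generalizing j with
  | zero =>
    obtain rfl : j = 0 := by simpa using hj
    refine ⟨Fin.elim0, fun i => i.elim0, ?_⟩
    ext z
    constructor
    · rintro ⟨t, -, rfl⟩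
      exact ⟨g t, (g t).2, rfl⟩
    · rintro ⟨y, hy, rfl⟩
      refine ⟨g.symm ⟨y, hy⟩, ?_, by simp⟩
      have := (g.symm ⟨y, hy⟩).2
      simp only [mem_ofPred_eq, pow_zero, div_one, Nat.cast_zero, zero_add]
      exact this
  | succ k ih =>
    have hL : 0 < ℓ ^ k := by positivity
    have hL0 : (0 : ℝ) < (ℓ : ℝ) ^ k := by positivity
    obtain ⟨q, m, hm, rfl⟩ : ∃ q m, m < ℓ ^ k ∧ j = ℓ ^ k * q + m :=
      ⟨j / ℓ ^ k, j % ℓ ^ k, Nat.mod_lt _ hL, (Nat.div_add_mod _ _).symm⟩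
    have hq : q < ℓ := by
      by_contra! h
      have := Nat.mul_le_mul_left (ℓ ^ k) h
      rw [pow_succ] at hj
      omega
    obtain ⟨m', hm', hmm'⟩ : ∃ m' < ℓ ^ k, ∀ s : ℝ,
        ((m : ℝ) ≤ s * (ℓ : ℝ) ^ k ∧ s * (ℓ : ℝ) ^ k ≤ m + 1) ↔
        ((m' : ℝ) ≤ flipReal (b q) s * (ℓ : ℝ) ^ k ∧
          flipReal (b q) s * (ℓ : ℝ) ^ k ≤ m' + 1) := by
      cases b q
      · exact ⟨m, hm, fun s => Iff.rfl⟩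
      · obtain ⟨d, hd⟩ := Nat.exists_eq_add_of_lt hm
        have hd' : (ℓ : ℝ) ^ k = m + d + 1 := by exact_mod_cast hd
        refine ⟨d, by omega, fun s => ?_⟩
        simp only [flipReal, if_true, sub_mul, one_mul]
        constructor <;> rintro ⟨h1, h2⟩ <;> constructor <;> linarith
    obtain ⟨w, hw, hwi⟩ := ih m' hm'
    refine ⟨Fin.cons q w, fun i => Fin.cases hq hw i, ?_⟩
    have hset : ∀ t t' : unitInterval, (t' : ℝ) = (q + flipReal (b q) t) / ℓ →
        ((((ℓ ^ k * q + m : ℕ) : ℝ) / (ℓ : ℝ) ^ (k + 1) ≤ t' ∧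
          (t' : ℝ) ≤ (((ℓ ^ k * q + m : ℕ) : ℝ) + 1) / (ℓ : ℝ) ^ (k + 1)) ↔
        ((m' : ℝ) / (ℓ : ℝ) ^ k ≤ t ∧ (t : ℝ) ≤ (m' + 1) / (ℓ : ℝ) ^ k)) := by
      intro t t' htt
      have h1 := hmm' (flipReal (b q) t)
      rw [flipReal_flipReal] at h1
      rw [div_le_iff₀ hL0, le_div_iff₀ hL0, ← h1, div_le_iff₀ (by positivity),
        le_div_iff₀ (by positivity)]
      have h2 : (t' : ℝ) * (ℓ : ℝ) ^ (k + 1) =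
          (ℓ : ℝ) ^ k * q + flipReal (b q) t * (ℓ : ℝ) ^ k := by
        rw [htt, pow_succ]
        field_simp
      rw [h2]
      push_cast
      constructor <;> rintro ⟨h1, h2⟩ <;> constructor <;> linarith
    have hflip : ∀ s : ℝ, s ∈ unitInterval → flipReal (b q) s ∈ unitInterval := fun s hs => by
      cases b q
      · exact hs
      · exact Icc.mem_iff_one_sub_mem.1 hs
    rw [List.ofFn_succ, List.foldr_cons]
    simp only [Fin.cons_zero, Fin.cons_succ]
    rw [image_comp, ← hwi]
    have hq1 : (q : ℝ) + 1 ≤ ℓ := by exact_mod_cast hq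
    ext z
    constructor
    · rintro ⟨t', ht', rfl⟩
      have hs : (ℓ : ℝ) * t' - q ∈ unitInterval := by
        have hm1 : (m : ℝ) + 1 ≤ (ℓ : ℝ) ^ k := by exact_mod_cast hm
        obtain ⟨h1, h2⟩ := ht'
        rw [div_le_iff₀ (by positivity), pow_succ] at h1
        rw [le_div_iff₀ (by positivity), pow_succ] at h2
        push_cast at h1 h2
        constructor
        · refine le_of_mul_le_mul_left (a := (ℓ : ℝ) ^ k) ?_ hL0
          have : (0 : ℝ) ≤ m := by positivity
          linarith
        · refine le_of_mul_le_mul_left (a := (ℓ : ℝ) ^ k) ?_ hL0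
          linarith
      have htt : (t' : ℝ) = (q + flipReal (b q) (flipReal (b q) ((ℓ : ℝ) * t' - q))) / ℓ := by
        rw [flipReal_flipReal]
        field_simp
        ring
      exact ⟨_, ⟨⟨_, hflip _ hs⟩, (hset _ _ htt).1 ht', rfl⟩, (hg q hq _ _ htt).symm⟩
    · rintro ⟨_, ⟨t, ht, rfl⟩, rfl⟩
      have hfl := hflip t t.2
      have ht' : ((q : ℝ) + flipReal (b q) t) / ℓ ∈ unitInterval :=
        ⟨div_nonneg (add_nonneg (by positivity) hfl.1) hℓ0.le,
          (div_le_one hℓ0).2 (by linarith [hfl.2])⟩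
      exact ⟨⟨_, ht'⟩, (hset t ⟨_, ht'⟩ rfl).2 ht, hg q hq _ _ rfl⟩

end Lift

theorem stmt2
    (N ℓ : ℕ) (hN : 1 ≤ N) (hℓ : 2 ≤ ℓ)
    (S : ℕ → EuclideanSpace ℝ (Fin N) → EuclideanSpace ℝ (Fin N))
    (r : ℕ → ℝ) (hr01 : ∀ j, 1 ≤ j → j ≤ ℓ → 0 < r j ∧ r j < 1)
    (hsim : ∀ j, 1 ≤ j → j ≤ ℓ → ∀ x y : EuclideanSpace ℝ (Fin N), ‖S j x - S j y‖ = r j * ‖x - y‖)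
    (Λ : Set (EuclideanSpace ℝ (Fin N))) (hne : Λ.Nonempty) (hcomp : IsCompact Λ)
    (hinv : Λ = ⋃ j ∈ Finset.Icc 1 ℓ, S j '' Λ)
    (harc : Nonempty (Set.Icc (0:ℝ) 1 ≃ₜ Λ))
    (hadj : ∀ j, 1 ≤ j → j ≤ ℓ - 1 → ∃ a, S j '' Λ ∩ S (j + 1) '' Λ = {a})
    (hdisj : ∀ i j, 1 ≤ i → i ≤ ℓ → 1 ≤ j → j ≤ ℓ → (i + 1 < j ∨ j + 1 < i) →
      Disjoint (S i '' Λ) (S j '' Λ))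
    :
    ∃ g : Set.Icc (0:ℝ) 1 ≃ₜ Λ, ∀ k : ℕ, 1 ≤ k →
      ∃ w : ℕ → Fin k → ℕ,
        (∀ j, 1 ≤ j → j ≤ ℓ ^ k → ∀ i, 1 ≤ w j i ∧ w j i ≤ ℓ) ∧
        (∀ j j', 1 ≤ j → j ≤ ℓ ^ k → 1 ≤ j' → j' ≤ ℓ ^ k → w j = w j' → j = j') ∧
        (∀ j, 1 ≤ j → j ≤ ℓ ^ k →
          (fun t : Set.Icc (0:ℝ) 1 => ((g t : EuclideanSpace ℝ (Fin N)))) ''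
              {t : Set.Icc (0:ℝ) 1 | ((j : ℝ) - 1) / (ℓ : ℝ) ^ k ≤ (t : ℝ) ∧ (t : ℝ) ≤ (j : ℝ) / (ℓ : ℝ) ^ k}
            = ((List.ofFn fun i => S (w j i)).foldr (· ∘ ·) id) '' Λ) := by
  have hSd : ∀ i < ℓ, ∀ x y, dist (S (i + 1) x) (S (i + 1) y) = r (i + 1) * dist x y :=
    fun i hi x y => by
      rw [dist_eq_norm, dist_eq_norm, hsim (i + 1) (by omega) (by omega)]
  have hc : ∀ i < ℓ, Continuous (S (i + 1)) := fun i hi =>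
    (LipschitzWith.of_dist_le_mul (K := ⟨r (i + 1), (hr01 (i + 1) (by omega) (by omega)).1.le⟩)
      fun x y => (hSd i hi x y).le).continuous
  have hinj : ∀ i < ℓ, Function.Injective (S (i + 1)) := fun i hi x y hxy => by
    have := hSd i hi x y
    rw [hxy, dist_self, zero_eq_mul] at this
    exact dist_eq_zero.1 (this.resolve_left (hr01 (i + 1) (by omega) (by omega)).1.ne')
  have hmem : ∀ z, z ∈ Λ ↔ ∃ i < ℓ, ∃ y ∈ Λ, S (i + 1) y = z := fun z => by
    conv_lhs => rw [hinv]
    simp only [mem_iUnion, Finset.mem_Icc, mem_image, exists_prop]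
    constructor
    · rintro ⟨i, ⟨h1, h2⟩, y, hy, rfl⟩
      exact ⟨i - 1, by omega, y, hy, by rw [Nat.sub_add_cancel h1]⟩
    · rintro ⟨i, hi, y, hy, rfl⟩
      exact ⟨i + 1, ⟨by omega, by omega⟩, y, hy, rfl⟩
  obtain ⟨h₀⟩ := harc
  obtain ⟨h, f, hf, hord⟩ := exists_ordered_lift hℓ (S := fun i => S (i + 1)) h₀ hc hinj
    (fun i hi x hx => (hmem _).2 ⟨i, hi, x, hx, rfl⟩)
    (fun i hi => hadj (i + 1) (by omega) (by omega))
    (fun i j hij hj => hdisj (i + 1) (j + 1) (by omega) (by omega) (by omega) (by omega)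
      (Or.inl (by omega)))
  have hcov : ∀ x, ∃ i < ℓ, ∃ y, f i y = x := fun x => by
    obtain ⟨i, hi, y, hy, hyx⟩ := (hmem _).1 (h x).2
    refine ⟨i, hi, h.symm ⟨y, hy⟩, h.injective (Subtype.ext ?_)⟩
    rw [hf i hi, h.apply_symm_apply, hyx]
  obtain ⟨ρ, hρ0, hρ1, hρ⟩ : ∃ ρ : ℝ, 0 ≤ ρ ∧ ρ < 1 ∧ ∀ i < ℓ, r (i + 1) ≤ ρ := by
    obtain ⟨i, hi, hmax⟩ := Finset.exists_max_image (Finset.range ℓ) (fun i => r (i + 1))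
      ⟨0, by simp; omega⟩
    rw [Finset.mem_range] at hi
    have := hr01 (i + 1) (by omega) (by omega)
    exact ⟨r (i + 1), this.1.le, this.2, fun j hj => hmax j (by simpa using hj)⟩
  obtain ⟨φ, b, hφ⟩ := exists_conj hℓ (fun i hi => continuous_of_lift h (hc i hi) (hf i hi))
    (fun i hi => injective_of_lift h (hinj i hi) (hf i hi)) hcov hord
    (exists_cell_subset_Icc hρ0 hρ1 (fun i hi x y => (hSd i hi x y).le.trans
      (mul_le_mul_of_nonneg_right (hρ i hi) dist_nonneg)) h hf hcov)
  let g := φ.symm.trans h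
  have hg : ∀ i < ℓ, ∀ t t' : unitInterval, (t' : ℝ) = (i + flipReal (b i) t) / ℓ →
      (g t' : EuclideanSpace ℝ (Fin N)) = S (i + 1) (g t) := fun i hi t t' htt => by
    have ht : t' = φ (f i (φ.symm t)) := Subtype.ext (by rw [hφ i hi, htt, φ.apply_symm_apply])
    change (h (φ.symm t') : EuclideanSpace ℝ (Fin N)) = S (i + 1) (h (φ.symm t))
    rw [ht, φ.symm_apply_apply, hf i hi]
  refine ⟨g, fun k _ => ?_⟩
  have hword : ∀ j : ℕ, ∃ w : Fin k → ℕ, 1 ≤ j → j ≤ ℓ ^ k → (∀ i, 1 ≤ w i ∧ w i ≤ ℓ) ∧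
      (fun t : Set.Icc (0:ℝ) 1 => ((g t : EuclideanSpace ℝ (Fin N)))) ''
        {t : Set.Icc (0:ℝ) 1 |
          ((j : ℝ) - 1) / (ℓ : ℝ) ^ k ≤ (t : ℝ) ∧ (t : ℝ) ≤ (j : ℝ) / (ℓ : ℝ) ^ k}
        = ((List.ofFn fun i => S (w i)).foldr (· ∘ ·) id) '' Λ := fun j => by
    by_cases hj : 1 ≤ j ∧ j ≤ ℓ ^ k
    · have hj' : j - 1 < ℓ ^ k := by omega
      obtain ⟨w, hw, hwi⟩ :=
        exists_word_image_eq hℓ (S := fun i => S (i + 1)) g b hg k (j - 1) hj'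
      refine ⟨fun i => w i + 1, fun _ _ => ⟨fun i => ⟨Nat.le_add_left 1 _, hw i⟩, ?_⟩⟩
      rw [← hwi]
      simp [Nat.cast_sub hj.1]
    · exact ⟨fun _ => 0, fun h1 h2 => absurd ⟨h1, h2⟩ hj⟩
  choose w hw using hword
  refine ⟨w, fun j h1 h2 => (hw j h1 h2).1, ?_, fun j h1 h2 => (hw j h1 h2).2⟩
  intro j j' h1 h2 h1' h2' he
  have hset := (hw j h1 h2).2
  rw [he, ← (hw j' h1' h2').2] at hset
  have hgi : Function.Injective fun t => (g t : EuclideanSpace ℝ (Fin N)) :=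
    Subtype.val_injective.comp g.injective
  replace hset := hgi.image_injective hset
  have hL0 : (0 : ℝ) < (ℓ : ℝ) ^ k := by positivity
  have key : ∀ i i' : ℕ, 1 ≤ i → i ≤ ℓ ^ k →
      {t : Set.Icc (0:ℝ) 1 |
        ((i : ℝ) - 1) / (ℓ : ℝ) ^ k ≤ (t : ℝ) ∧ (t : ℝ) ≤ (i : ℝ) / (ℓ : ℝ) ^ k} =
      {t : Set.Icc (0:ℝ) 1 |
        ((i' : ℝ) - 1) / (ℓ : ℝ) ^ k ≤ (t : ℝ) ∧ (t : ℝ) ≤ (i' : ℝ) / (ℓ : ℝ) ^ k} →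
      i ≤ i' := fun i i' h1 h2 hs => by
    have h2' : (i : ℝ) ≤ (ℓ : ℝ) ^ k := by exact_mod_cast h2
    have hI : (i : ℝ) / (ℓ : ℝ) ^ k ∈ Icc (0 : ℝ) 1 := ⟨by positivity, (div_le_one hL0).2 h2'⟩
    have hmem : (⟨_, hI⟩ : Icc (0 : ℝ) 1) ∈ {t : Set.Icc (0:ℝ) 1 |
        ((i : ℝ) - 1) / (ℓ : ℝ) ^ k ≤ (t : ℝ) ∧ (t : ℝ) ≤ (i : ℝ) / (ℓ : ℝ) ^ k} :=
      ⟨div_le_div_of_nonneg_right (by linarith) hL0.le, le_rfl⟩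
    rw [hs] at hmem
    exact_mod_cast (div_le_div_iff_of_pos_right hL0).1 hmem.2
  exact le_antisymm (key j j' h1 h2 hset) (key j' j h1' h2' hset.symm)
end
end

section
/- Let t ≥ 1 be a real number. Then Λ is a t-quasi-arc if and only if Condition Q_p^t holds for every p ∈ {1,…,ℓ−1}. -/
open MeasureTheory Set Filter

noncomputable section

/-- The part of the curve `γ` between the parameters `a` and `b`. -/
def subarc {E : Type*} (γ : Set.Icc (0 : ℝ) 1 → E) (a b : Set.Icc (0 : ℝ) 1) : Set E :=
  γ '' {u | min (a : ℝ) (b : ℝ) ≤ (u : ℝ) ∧ (u : ℝ) ≤ max (a : ℝ) (b : ℝ)}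

theorem subarc_comm {E : Type*} (γ : Set.Icc (0 : ℝ) 1 → E) (a b : Set.Icc (0 : ℝ) 1) :
    subarc γ a b = subarc γ b a := by
  simp only [subarc, min_comm (a : ℝ), max_comm (a : ℝ)]

theorem subarc_self {E : Type*} (γ : Set.Icc (0 : ℝ) 1 → E) (a : Set.Icc (0 : ℝ) 1) :
    subarc γ a a = {γ a} := by
  have : {u : Set.Icc (0 : ℝ) 1 | min (a : ℝ) (a : ℝ) ≤ (u : ℝ) ∧ (u : ℝ) ≤ max (a : ℝ) (a : ℝ)}
      = {a} := by
    ext u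
    simp only [min_self, max_self, Set.mem_ofPred_eq, Set.mem_singleton_iff, Subtype.ext_iff]
    exact ⟨fun h => le_antisymm h.2 h.1, fun h => ⟨h.ge, h.le⟩⟩
  rw [subarc, this, Set.image_singleton]

theorem subarc_subset_range {E : Type*} (γ : Set.Icc (0 : ℝ) 1 → E) (a b : Set.Icc (0 : ℝ) 1) :
    subarc γ a b ⊆ Set.range γ :=
  Set.image_subset_range _ _

/-- Intermediate value theorem for continuous self-maps of the parameter interval. -/
theorem subarc_map_subset {E : Type*} (γ : Set.Icc (0 : ℝ) 1 → E)
    (h : Set.Icc (0 : ℝ) 1 → Set.Icc (0 : ℝ) 1) (hc : Continuous h) (a b : Set.Icc (0 : ℝ) 1) :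
    subarc γ (h a) (h b) ⊆ subarc (γ ∘ h) a b := by
  rintro _ ⟨v, hv, rfl⟩
  have h01 : (0 : ℝ) ≤ 1 := zero_le_one
  let F : ℝ → ℝ := fun x => (h (Set.projIcc 0 1 h01 x) : ℝ)
  have hF : Continuous F := continuous_subtype_val.comp (hc.comp continuous_projIcc)
  have hFv (x : Set.Icc (0 : ℝ) 1) : F x = h x := by simp [F]
  have hmem : (v : ℝ) ∈ Set.uIcc (F a) (F b) := by rw [hFv, hFv]; exact hv
  obtain ⟨x, hx, hxv⟩ := intermediate_value_uIcc hF.continuousOn hmem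
  have hx01 : x ∈ Set.Icc (0 : ℝ) 1 :=
    ⟨(le_min a.2.1 b.2.1).trans hx.1, hx.2.trans (max_le a.2.2 b.2.2)⟩
  refine ⟨⟨x, hx01⟩, hx, ?_⟩
  have : h ⟨x, hx01⟩ = v := Subtype.ext ((hFv ⟨x, hx01⟩).symm.trans hxv)
  simp [this]

/-- A subarc of a curve scaled by `f` is the image of the original subarc, so its diameter
scales. -/
theorem diam_subarc_map_le {E : Type*} [PseudoMetricSpace E] {γ : Set.Icc (0 : ℝ) 1 → E}
    (hb : Bornology.IsBounded (Set.range γ)) {f : E → E} {r : ℝ} (hr : 0 ≤ r)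
    (hf : ∀ x y, dist (f x) (f y) = r * dist x y)
    {h : Set.Icc (0 : ℝ) 1 → Set.Icc (0 : ℝ) 1} (hc : Continuous h)
    (hγ : ∀ u, γ (h u) = f (γ u)) (a b : Set.Icc (0 : ℝ) 1) :
    Metric.diam (subarc γ (h a) (h b)) ≤ r * Metric.diam (subarc γ a b) := by
  refine Metric.diam_le_of_forall_dist_le (mul_nonneg hr Metric.diam_nonneg) ?_
  intro x hx y hy
  obtain ⟨u, hu, rfl⟩ := subarc_map_subset γ h hc a b hx
  obtain ⟨v, hv, rfl⟩ := subarc_map_subset γ h hc a b hy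
  simp only [Function.comp_apply, hγ, hf]
  exact mul_le_mul_of_nonneg_left (Metric.dist_le_diam_of_mem
    (hb.subset (subarc_subset_range γ a b)) (Set.mem_image_of_mem γ hu)
    (Set.mem_image_of_mem γ hv)) hr

/-- Points of an arc whose parameters are at least `ε` apart stay uniformly apart. -/
theorem exists_pos_le_dist_of_le_sub {E : Type*} [MetricSpace E] {γ : Set.Icc (0 : ℝ) 1 → E}
    (hc : Continuous γ) (hinj : Function.Injective γ) {ε : ℝ} (hε : 0 < ε) :
    ∃ δ > 0, ∀ a b : Set.Icc (0 : ℝ) 1, ε ≤ (b : ℝ) - a → δ ≤ dist (γ a) (γ b) := by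
  let K : Set (Set.Icc (0 : ℝ) 1 × Set.Icc (0 : ℝ) 1) := {q | ε ≤ (q.2 : ℝ) - q.1}
  have hK : IsCompact K := (isClosed_le continuous_const (by fun_prop)).isCompact
  obtain hK0 | hK0 := K.eq_empty_or_nonempty
  · refine ⟨1, one_pos, fun a b hab => ?_⟩
    have : (a, b) ∈ K := hab
    simp [hK0] at this
  · obtain ⟨q, hq, hmin⟩ := hK.exists_isMinOn hK0
      (f := fun q => dist (γ q.1) (γ q.2)) (by fun_prop)
    refine ⟨dist (γ q.1) (γ q.2), dist_pos.2 fun heq => ?_, fun a b hab => hmin (a := (a, b)) hab⟩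
    have hq' : ε ≤ (q.2 : ℝ) - q.1 := hq
    rw [hinj heq, sub_self] at hq'
    exact hq'.not_gt hε

theorem exists_nat_div_interval {ℓ : ℕ} (hℓ : 0 < ℓ) {x : ℝ} (hx : x ∈ Set.Icc (0 : ℝ) 1) :
    ∃ p : ℕ, 1 ≤ p ∧ p ≤ ℓ ∧ ((p : ℝ) - 1) / ℓ ≤ x ∧ x ≤ (p : ℝ) / ℓ := by
  have hℓ' : (0 : ℝ) < ℓ := by exact_mod_cast hℓ
  obtain hx0 | hx0 := hx.1.eq_or_lt
  · exact ⟨1, le_rfl, hℓ, by simp [← hx0], by rw [← hx0]; positivity⟩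
  · have hpos : 0 < x * ℓ := mul_pos hx0 hℓ'
    refine ⟨⌈x * ℓ⌉₊, Nat.ceil_pos.2 hpos, Nat.ceil_le.2 ?_, ?_, ?_⟩
    · exact mul_le_of_le_one_left hℓ'.le hx.2
    · rw [div_le_iff₀ hℓ']
      linarith [Nat.ceil_lt_add_one hpos.le]
    · rw [le_div_iff₀ hℓ']
      exact Nat.le_ceil _

/-- If `γ` is covered by finitely many self-similar pieces and every pair of parameters either
satisfies the `t`-quasi-arc inequality or lies in a common piece, then `γ` satisfies the
`t`-quasi-arc inequality everywhere. -/
theorem diam_subarc_rpow_le_of_selfSimilar {E : Type*} [MetricSpace E]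
    {γ : Set.Icc (0 : ℝ) 1 → E} (hb : Bornology.IsBounded (Set.range γ))
    (hinj : Function.Injective γ) {t lam ρ : ℝ} (ht : 1 ≤ t) (hρ1 : ρ < 1)
    (hstep : ∀ a b, Metric.diam (subarc γ a b) ^ t ≤ lam * dist (γ a) (γ b) ∨
      ∃ (f : E → E) (s : ℝ) (h : Set.Icc (0 : ℝ) 1 → Set.Icc (0 : ℝ) 1) (u v : Set.Icc (0 : ℝ) 1),
        0 < s ∧ s ≤ ρ ∧ (∀ x y, dist (f x) (f y) = s * dist x y) ∧ Continuous h ∧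
        (∀ w, γ (h w) = f (γ w)) ∧ h u = a ∧ h v = b)
    (a b : Set.Icc (0 : ℝ) 1) :
    Metric.diam (subarc γ a b) ^ t ≤ lam * dist (γ a) (γ b) := by
  have main : ∀ (n : ℕ) (a b : Set.Icc (0 : ℝ) 1),
      Metric.diam (Set.range γ) * ρ ^ n < dist (γ a) (γ b) →
      Metric.diam (subarc γ a b) ^ t ≤ lam * dist (γ a) (γ b) := by
    intro n
    induction n with
    | zero =>
      intro a b hab
      rw [pow_zero, mul_one] at hab
      exact absurd (Metric.dist_le_diam_of_mem hb ⟨a, rfl⟩ ⟨b, rfl⟩) hab.not_ge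
    | succ n ih =>
      intro a b hab
      obtain hP | ⟨f, s, h, u, v, hs, hsρ, hf, hc, hγ, rfl, rfl⟩ := hstep a b
      · exact hP
      have hd : dist (γ (h u)) (γ (h v)) = s * dist (γ u) (γ v) := by rw [hγ, hγ, hf]
      have huv : Metric.diam (Set.range γ) * ρ ^ n < dist (γ u) (γ v) := by
        have hρ : 0 < ρ := hs.trans_le hsρ
        rw [hd] at hab
        refine lt_of_mul_lt_mul_left (?_ : ρ * _ < ρ * _) hρ.le
        calc ρ * (Metric.diam (Set.range γ) * ρ ^ n)
            = Metric.diam (Set.range γ) * ρ ^ (n + 1) := by ring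
          _ < s * dist (γ u) (γ v) := hab
          _ ≤ ρ * dist (γ u) (γ v) := mul_le_mul_of_nonneg_right hsρ dist_nonneg
      calc Metric.diam (subarc γ (h u) (h v)) ^ t
          ≤ (s * Metric.diam (subarc γ u v)) ^ t :=
            Real.rpow_le_rpow Metric.diam_nonneg (diam_subarc_map_le hb hs.le hf hc hγ u v)
              (zero_le_one.trans ht)
        _ = s ^ t * Metric.diam (subarc γ u v) ^ t := Real.mul_rpow hs.le Metric.diam_nonneg
        _ ≤ s * Metric.diam (subarc γ u v) ^ t :=
            mul_le_mul_of_nonneg_right (Real.rpow_le_self_of_le_one hs.le (hsρ.trans hρ1.le) ht)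
              (Real.rpow_nonneg Metric.diam_nonneg _)
        _ ≤ s * (lam * dist (γ u) (γ v)) := mul_le_mul_of_nonneg_left (ih u v huv) hs.le
        _ = lam * dist (γ (h u)) (γ (h v)) := by rw [hd]; ring
  by_cases hab : a = b
  · subst hab
    rw [subarc_self, Metric.diam_singleton, dist_self, mul_zero,
      Real.zero_rpow (zero_lt_one.trans_le ht).ne']
  obtain hP | ⟨_, s, _, _, _, hs, hsρ, _⟩ := hstep a b
  · exact hP
  have hlim : Tendsto (fun n : ℕ => Metric.diam (Set.range γ) * ρ ^ n) atTop (nhds 0) := by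
    simpa using (tendsto_pow_atTop_nhds_zero_of_lt_one (hs.trans_le hsρ).le hρ1).const_mul
      (Metric.diam (Set.range γ))
  obtain ⟨n, hn⟩ := (hlim.eventually_lt_const (dist_pos.2 (hinj.ne hab))).exists
  exact main n a b hn

theorem stmt5
    (N ℓ : ℕ) (hN : 1 ≤ N) (hℓ : 2 ≤ ℓ)
    (S : ℕ → EuclideanSpace ℝ (Fin N) → EuclideanSpace ℝ (Fin N))
    (r : ℕ → ℝ) (hr01 : ∀ j, 1 ≤ j → j ≤ ℓ → 0 < r j ∧ r j < 1)
    (hsim : ∀ j, 1 ≤ j → j ≤ ℓ → ∀ x y : EuclideanSpace ℝ (Fin N), ‖S j x - S j y‖ = r j * ‖x - y‖)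
    (Λ : Set (EuclideanSpace ℝ (Fin N))) (hne : Λ.Nonempty) (hcomp : IsCompact Λ)
    (hinv : Λ = ⋃ j ∈ Finset.Icc 1 ℓ, S j '' Λ)
    (harc : Nonempty (Set.Icc (0:ℝ) 1 ≃ₜ Λ))
    (hadj : ∀ j, 1 ≤ j → j ≤ ℓ - 1 → ∃ a, S j '' Λ ∩ S (j + 1) '' Λ = {a})
    (hdisj : ∀ i j, 1 ≤ i → i ≤ ℓ → 1 ≤ j → j ≤ ℓ → (i + 1 < j ∨ j + 1 < i) →
      Disjoint (S i '' Λ) (S j '' Λ))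
    (g : Set.Icc (0:ℝ) 1 ≃ₜ Λ)
    (hg : ∀ k : ℕ, 1 ≤ k → ∀ j : ℕ, 1 ≤ j → j ≤ ℓ ^ k → ∃ w : Fin k → ℕ,
      (∀ i, 1 ≤ w i ∧ w i ≤ ℓ) ∧
      (fun t : Set.Icc (0:ℝ) 1 => ((g t : EuclideanSpace ℝ (Fin N)))) ''
          {t : Set.Icc (0:ℝ) 1 | ((j : ℝ) - 1) / (ℓ : ℝ) ^ k ≤ (t : ℝ) ∧ (t : ℝ) ≤ (j : ℝ) / (ℓ : ℝ) ^ k}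
        = ((List.ofFn fun i => S (w i)).foldr (· ∘ ·) id) '' Λ)
    (t : ℝ) (ht : 1 ≤ t) :
    (∃ lam > (0:ℝ), ∀ t₁ t₂ : Set.Icc (0:ℝ) 1,
        (Metric.diam ((fun u : Set.Icc (0:ℝ) 1 => ((g u : EuclideanSpace ℝ (Fin N)))) ''
          {u : Set.Icc (0:ℝ) 1 | min (t₁ : ℝ) (t₂ : ℝ) ≤ (u : ℝ) ∧ (u : ℝ) ≤ max (t₁ : ℝ) (t₂ : ℝ)})) ^ t ≤ lam * ‖((g t₁ : EuclideanSpace ℝ (Fin N))) - ((g t₂ : EuclideanSpace ℝ (Fin N)))‖) ↔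
    (∀ p : ℕ, 1 ≤ p → p ≤ ℓ - 1 → ∃ C > (0:ℝ),
      ∀ t₁ t₂ : Set.Icc (0:ℝ) 1,
        ((p : ℝ) - 1) / (ℓ : ℝ) ≤ (t₁ : ℝ) → (t₁ : ℝ) ≤ (p : ℝ) / (ℓ : ℝ) →
        (p : ℝ) / (ℓ : ℝ) ≤ (t₂ : ℝ) → (t₂ : ℝ) ≤ ((p : ℝ) + 1) / (ℓ : ℝ) →
        (Metric.diam ((fun u : Set.Icc (0:ℝ) 1 => ((g u : EuclideanSpace ℝ (Fin N)))) ''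
          {u : Set.Icc (0:ℝ) 1 | min (t₁ : ℝ) (t₂ : ℝ) ≤ (u : ℝ) ∧ (u : ℝ) ≤ max (t₁ : ℝ) (t₂ : ℝ)})) ^ t ≤ C * ‖((g t₁ : EuclideanSpace ℝ (Fin N))) - ((g t₂ : EuclideanSpace ℝ (Fin N)))‖) := by
  let γ : Set.Icc (0 : ℝ) 1 → EuclideanSpace ℝ (Fin N) := fun u => (g u : EuclideanSpace ℝ (Fin N))
  have hγc : Continuous γ := continuous_subtype_val.comp g.continuous
  have hγi : Function.Injective γ := Subtype.val_injective.comp g.injective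
  have hγb : Bornology.IsBounded (Set.range γ) :=
    hcomp.isBounded.subset (Set.range_subset_iff.2 fun u => (g u).2)
  constructor
  · rintro ⟨lam, hlam, H⟩ p - -
    exact ⟨lam, hlam, fun t₁ t₂ _ _ _ _ => H t₁ t₂⟩
  intro HQ
  have HQ' : ∀ p : ℕ, ∃ C > (0 : ℝ), 1 ≤ p → p ≤ ℓ - 1 → ∀ t₁ t₂ : Set.Icc (0:ℝ) 1,
      ((p : ℝ) - 1) / (ℓ : ℝ) ≤ (t₁ : ℝ) → (t₁ : ℝ) ≤ (p : ℝ) / (ℓ : ℝ) →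
      (p : ℝ) / (ℓ : ℝ) ≤ (t₂ : ℝ) → (t₂ : ℝ) ≤ ((p : ℝ) + 1) / (ℓ : ℝ) →
      Metric.diam (subarc γ t₁ t₂) ^ t ≤ C * dist (γ t₁) (γ t₂) := by
    intro p
    by_cases hp : 1 ≤ p ∧ p ≤ ℓ - 1
    · obtain ⟨C, hC, H⟩ := HQ p hp.1 hp.2
      exact ⟨C, hC, fun _ _ a b h₁ h₂ h₃ h₄ => by
        rw [dist_eq_norm]; exact H a b h₁ h₂ h₃ h₄⟩
    · exact ⟨1, one_pos, fun h₁ h₂ => absurd ⟨h₁, h₂⟩ hp⟩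
  choose C hC HC using HQ'
  have hℓ0 : (0 : ℝ) < ℓ := by exact_mod_cast (by omega : 0 < ℓ)
  obtain ⟨δ, hδ, Hδ⟩ := exists_pos_le_dist_of_le_sub hγc hγi (one_div_pos.2 hℓ0)
  have hD : 0 ≤ Metric.diam (Set.range γ) ^ t / δ :=
    div_nonneg (Real.rpow_nonneg Metric.diam_nonneg _) hδ.le
  have hsum : 0 < ∑ p ∈ Finset.range ℓ, C p :=
    Finset.sum_pos (fun p _ => hC p) ⟨0, Finset.mem_range.2 (by omega)⟩
  set lam : ℝ := Metric.diam (Set.range γ) ^ t / δ + ∑ p ∈ Finset.range ℓ, C p with hlam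
  obtain ⟨j₀, hj₀, hmax⟩ := Finset.exists_max_image (Finset.Icc 1 ℓ) r
    ⟨1, Finset.mem_Icc.2 ⟨le_rfl, by omega⟩⟩
  rw [Finset.mem_Icc] at hj₀
  have key : ∀ a b : Set.Icc (0 : ℝ) 1, (a : ℝ) ≤ b →
      Metric.diam (subarc γ a b) ^ t ≤ lam * dist (γ a) (γ b) ∨
      ∃ (f : EuclideanSpace ℝ (Fin N) → EuclideanSpace ℝ (Fin N)) (s : ℝ)
        (h : Set.Icc (0 : ℝ) 1 → Set.Icc (0 : ℝ) 1) (u v : Set.Icc (0 : ℝ) 1),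
        0 < s ∧ s ≤ r j₀ ∧ (∀ x y, dist (f x) (f y) = s * dist x y) ∧ Continuous h ∧
        (∀ w, γ (h w) = f (γ w)) ∧ h u = a ∧ h v = b := by
    intro a b hab
    by_cases hfar : 1 / (ℓ : ℝ) ≤ (b : ℝ) - a
    · left
      calc Metric.diam (subarc γ a b) ^ t ≤ Metric.diam (Set.range γ) ^ t :=
            Real.rpow_le_rpow Metric.diam_nonneg
              (Metric.diam_mono (subarc_subset_range γ a b) hγb) (zero_le_one.trans ht)
        _ = Metric.diam (Set.range γ) ^ t / δ * δ := (div_mul_cancel₀ _ hδ.ne').symm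
        _ ≤ lam * dist (γ a) (γ b) :=
            mul_le_mul (by linarith) (Hδ a b hfar) hδ.le (by linarith)
    obtain ⟨p, hp1, hpℓ, hpa, hap⟩ := exists_nat_div_interval (by omega : 0 < ℓ) a.2
    obtain hbp | hbp := le_or_gt (b : ℝ) ((p : ℝ) / ℓ)
    · right
      obtain ⟨w, hw, himg⟩ := hg 1 le_rfl p hp1 (by simpa using hpℓ)
      obtain ⟨hj1, hjℓ⟩ := hw 0
      have hpiece : γ '' {u | ((p : ℝ) - 1) / ℓ ≤ (u : ℝ) ∧ (u : ℝ) ≤ (p : ℝ) / ℓ} =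
          S (w 0) '' Λ := by
        simpa using himg
      have hmaps (x) (hx : x ∈ Λ) : S (w 0) x ∈ Λ := by
        rw [hinv]
        exact Set.mem_biUnion (Finset.mem_Icc.2 ⟨hj1, hjℓ⟩) (Set.mem_image_of_mem _ hx)
      have hdist (x y) : dist (S (w 0) x) (S (w 0) y) = r (w 0) * dist x y := by
        simpa only [dist_eq_norm] using hsim (w 0) hj1 hjℓ x y
      have hScont : Continuous (S (w 0)) :=
        (LipschitzWith.of_dist_le_mul (K := ⟨r (w 0), (hr01 _ hj1 hjℓ).1.le⟩)
          fun x y => (hdist x y).le).continuous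
      let h : Set.Icc (0 : ℝ) 1 → Set.Icc (0 : ℝ) 1 := fun u =>
        g.symm ⟨S (w 0) (γ u), hmaps _ (g u).2⟩
      have hγh (u) : γ (h u) = S (w 0) (γ u) := by simp [γ, h]
      have hlift (c : Set.Icc (0 : ℝ) 1) (h₁ : ((p : ℝ) - 1) / ℓ ≤ (c : ℝ))
          (h₂ : (c : ℝ) ≤ (p : ℝ) / ℓ) : ∃ u, h u = c := by
        have hc : γ c ∈ S (w 0) '' Λ := hpiece ▸ ⟨c, ⟨h₁, h₂⟩, rfl⟩
        obtain ⟨x, hx, hxc⟩ := hc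
        refine ⟨g.symm ⟨x, hx⟩, hγi ?_⟩
        rw [hγh, ← hxc]
        simp [γ]
      obtain ⟨u, hu⟩ := hlift a hpa hap
      obtain ⟨v, hv⟩ := hlift b (hpa.trans hab) hbp
      exact ⟨S (w 0), r (w 0), h, u, v, (hr01 _ hj1 hjℓ).1,
        hmax _ (Finset.mem_Icc.2 ⟨hj1, hjℓ⟩), hdist,
        g.symm.continuous.comp ((hScont.comp hγc).subtype_mk _), hγh, hu, hv⟩
    · left
      have hpℓ' : p < ℓ := by
        have := hbp.trans_le b.2.2
        rw [div_lt_one hℓ0] at this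
        exact_mod_cast this
      have hb2 : (b : ℝ) ≤ ((p : ℝ) + 1) / ℓ := by
        rw [add_div]
        linarith
      refine (HC p hp1 (by omega) a b hpa hap hbp.le hb2).trans
        (mul_le_mul_of_nonneg_right ?_ dist_nonneg)
      have := Finset.single_le_sum (f := C) (fun q _ => (hC q).le) (Finset.mem_range.2 hpℓ')
      linarith
  refine ⟨lam, by linarith, fun a b => ?_⟩
  rw [← dist_eq_norm]
  refine diam_subarc_rpow_le_of_selfSimilar hγb hγi ht (hr01 j₀ hj₀.1 hj₀.2).2 (fun a b => ?_) a b
  obtain hab | hab := le_total (a : ℝ) b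
  · exact key a b hab
  · rw [subarc_comm, dist_comm]
    refine (key b a hab).imp_right ?_
    rintro ⟨f, s, h, u, v, hs, hsρ, hf, hc, hγ, hu, hv⟩
    exact ⟨f, s, h, v, u, hs, hsρ, hf, hc, hγ, hv, hu⟩
end
end

section
/- If S_j(Λ) ∩ S_{j+1}(Λ) = {z_j} for every j = 1,…,ℓ−1, then Λ is an arc: there exists a homeomorphism from the unit interval [0,1] onto Λ. -/
open MeasureTheory Set Filter

noncomputable section

/-- A chain of `ℓ` contractions `φ 1, …, φ ℓ` with compact attractor `K` and endpoints `p ≠ q`: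
the consecutive pieces `φ j '' K` and `φ (j + 1) '' K` meet only in `φ j q = φ (j + 1) p`, and
pieces that are not consecutive are disjoint. -/
structure IsContractionChain {X : Type*} [MetricSpace X] (ℓ : ℕ) (r : ℝ) (φ : ℕ → X → X)
    (K : Set X) (p q : X) : Prop where
  one_le : 1 ≤ ℓ
  ratio_nonneg : 0 ≤ r
  ratio_lt_one : r < 1
  isCompact : IsCompact K
  left_mem : p ∈ K
  right_mem : q ∈ K
  left_ne_right : p ≠ q
  dist_le : ∀ j ∈ Icc 1 ℓ, ∀ x y, dist (φ j x) (φ j y) ≤ r * dist x y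
  injective : ∀ j ∈ Icc 1 ℓ, Function.Injective (φ j)
  mapsTo : ∀ j ∈ Icc 1 ℓ, MapsTo (φ j) K K
  cover : ∀ x ∈ K, ∃ j ∈ Icc 1 ℓ, ∃ y ∈ K, φ j y = x
  map_left : φ 1 p = p
  map_right : φ ℓ q = q
  glue : ∀ j ∈ Icc 1 ℓ, j + 1 ∈ Icc 1 ℓ → φ j q = φ (j + 1) p
  eq_of_adjacent : ∀ j ∈ Icc 1 ℓ, j + 1 ∈ Icc 1 ℓ → ∀ x ∈ K, ∀ y ∈ K,
    φ j x = φ (j + 1) y → x = q ∧ y = p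
  ne_of_far : ∀ i ∈ Icc 1 ℓ, ∀ j ∈ Icc 1 ℓ, i + 1 < j → ∀ x ∈ K, ∀ y ∈ K, φ i x ≠ φ j y

lemma nonpos_of_forall_le_pow_mul {d r C : ℝ} (hr0 : 0 ≤ r) (hr1 : r < 1)
    (h : ∀ n : ℕ, d ≤ r ^ n * C) : d ≤ 0 := by
  have ht : Tendsto (fun n : ℕ => r ^ n * C) atTop (nhds (0 * C)) :=
    (tendsto_pow_atTop_nhds_zero_of_lt_one hr0 hr1).mul_const C
  rw [zero_mul] at ht
  exact ge_of_tendsto' ht h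

/-- A bounded relation all of whose pairs are contracted images of pairs of the relation is
contained in the diagonal. -/
lemma eq_of_bounded_expanding {Y : Type*} [MetricSpace Y] {P : Y → Y → Prop} {r C : ℝ}
    (hr0 : 0 ≤ r) (hr1 : r < 1) (hC : ∀ u v, P u v → dist u v ≤ C)
    (hP : ∀ u v, P u v → u = v ∨ ∃ u' v', P u' v' ∧ dist u v ≤ r * dist u' v')
    {u v : Y} (h : P u v) : u = v := by
  have key : ∀ n : ℕ, ∀ u v, P u v → dist u v ≤ r ^ n * C := by
    intro n
    induction n with
    | zero => simpa using hC
    | succ n ih =>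
      intro u v huv
      rcases hP u v huv with rfl | ⟨u', v', h', hd⟩
      · have hC0 : 0 ≤ C := dist_nonneg.trans (hC _ _ huv)
        rw [dist_self]
        positivity
      · calc dist u v ≤ r * dist u' v' := hd
          _ ≤ r * (r ^ n * C) := by gcongr; exact ih _ _ h'
          _ = r ^ (n + 1) * C := by ring
  exact dist_le_zero.1 (nonpos_of_forall_le_pow_mul hr0 hr1 fun n => key n u v h)

namespace IsContractionChain

variable {X Y : Type*} [MetricSpace X] [MetricSpace Y] {ℓ : ℕ} {r s : ℝ}
  {φ : ℕ → X → X} {ψ : ℕ → Y → Y} {K : Set X} {L : Set Y} {p q : X} {p' q' : Y}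

lemma one_mem (h : IsContractionChain ℓ r φ K p q) : 1 ∈ Icc 1 ℓ := ⟨le_rfl, h.one_le⟩

lemma last_mem (h : IsContractionChain ℓ r φ K p q) : ℓ ∈ Icc 1 ℓ := ⟨h.one_le, le_rfl⟩

lemma continuous (h : IsContractionChain ℓ r φ K p q) {j : ℕ} (hj : j ∈ Icc 1 ℓ) :
    Continuous (φ j) :=
  (LipschitzWith.of_dist_le_mul (K := ⟨r, h.ratio_nonneg⟩) (h.dist_le j hj)).continuous

lemma exists_dist_le (h : IsContractionChain ℓ r φ K p q) :
    ∃ C, ∀ x ∈ K, ∀ y ∈ K, dist x y ≤ C :=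
  ⟨_, fun _ hx _ hy => Metric.dist_le_diam_of_mem h.isCompact.isBounded hx hy⟩

lemma eq_of_map_eq_left (h : IsContractionChain ℓ r φ K p q) {j : ℕ} (hj : j ∈ Icc 1 ℓ)
    {x : X} (hx : x ∈ K) (he : φ j x = p) : j = 1 ∧ x = p := by
  have he' : φ 1 p = φ j x := h.map_left.trans he.symm
  obtain rfl | rfl | h3 : j = 1 ∨ j = 1 + 1 ∨ 1 + 1 < j := by have := hj.1; omega
  · exact ⟨rfl, (h.injective _ hj he').symm⟩
  · exact absurd (h.eq_of_adjacent 1 h.one_mem hj p h.left_mem x hx he').1 h.left_ne_right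
  · exact absurd he' (h.ne_of_far 1 h.one_mem j hj h3 p h.left_mem x hx)

lemma eq_of_map_eq_right (h : IsContractionChain ℓ r φ K p q) {j : ℕ} (hj : j ∈ Icc 1 ℓ)
    {x : X} (hx : x ∈ K) (he : φ j x = q) : j = ℓ ∧ x = q := by
  have he' : φ j x = φ ℓ q := he.trans h.map_right.symm
  obtain rfl | rfl | h3 : j = ℓ ∨ ℓ = j + 1 ∨ j + 1 < ℓ := by have := hj.2; omega
  · exact ⟨rfl, h.injective _ hj he'⟩
  · exact absurd (h.eq_of_adjacent j hj h.last_mem x hx q h.right_mem he').2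
      h.left_ne_right.symm
  · exact absurd he' (h.ne_of_far j hj ℓ h.last_mem h3 x hx q h.right_mem)

/-- The attractor is contained in every nonempty closed forward invariant set. -/
lemma subset_of_mapsTo (h : IsContractionChain ℓ r φ K p q) {A : Set X} (hA : IsClosed A)
    (hp : p ∈ A) (hm : ∀ j ∈ Icc 1 ℓ, MapsTo (φ j) A A) : K ⊆ A := by
  obtain ⟨C, hC⟩ := h.exists_dist_le
  have key : ∀ n : ℕ, ∀ x ∈ K, ∃ a ∈ A, dist x a ≤ r ^ n * C := by
    intro n
    induction n with
    | zero => exact fun x hx => ⟨p, hp, by simpa using hC x hx p h.left_mem⟩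
    | succ n ih =>
      intro x hx
      obtain ⟨j, hj, y, hy, rfl⟩ := h.cover x hx
      obtain ⟨a, ha, hd⟩ := ih y hy
      refine ⟨φ j a, hm j hj ha, (h.dist_le j hj y a).trans ?_⟩
      rw [pow_succ', mul_assoc]
      exact mul_le_mul_of_nonneg_left hd h.ratio_nonneg
  intro x hx
  rw [hA.mem_iff_infDist_zero ⟨p, hp⟩]
  refine le_antisymm
    (nonpos_of_forall_le_pow_mul (C := C) h.ratio_nonneg h.ratio_lt_one fun n => ?_)
    Metric.infDist_nonneg
  obtain ⟨a, ha, hd⟩ := key n x hx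
  exact (Metric.infDist_le_dist_of_mem ha).trans hd

/-- A relation between the attractors of two chains that is compatible with the coding by the
pieces is the graph of a partial function. -/
lemma right_unique_of_compatible (h : IsContractionChain ℓ r φ K p q)
    (h' : IsContractionChain ℓ s ψ L p' q') {R : X → Y → Prop}
    (hK : ∀ x y, R x y → x ∈ K) (hL : ∀ x y, R x y → y ∈ L)
    (hR : ∀ x y, R x y → ∃ j ∈ Icc 1 ℓ, ∃ a b, R a b ∧ φ j a = x ∧ ψ j b = y)
    {x : X} {y y' : Y} (hy : R x y) (hy' : R x y') : y = y' := by
  obtain ⟨C, hC⟩ := h'.exists_dist_le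
  have left : ∀ y, R p y → y = p' := fun y hy => by
    refine eq_of_bounded_expanding (P := fun u v => R p u ∧ v = p') h'.ratio_nonneg
      h'.ratio_lt_one (C := C) ?_ ?_ ⟨hy, rfl⟩
    · rintro u _ ⟨hu, rfl⟩
      exact hC u (hL _ _ hu) _ h'.left_mem
    · rintro u v ⟨hu, rfl⟩
      obtain ⟨j, hj, a, b, hab, ha, rfl⟩ := hR _ _ hu
      obtain ⟨rfl, rfl⟩ := h.eq_of_map_eq_left hj (hK _ _ hab) ha
      refine Or.inr ⟨b, _, ⟨hab, rfl⟩, ?_⟩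
      simpa only [h'.map_left] using h'.dist_le _ hj b v
  have right : ∀ y, R q y → y = q' := fun y hy => by
    refine eq_of_bounded_expanding (P := fun u v => R q u ∧ v = q') h'.ratio_nonneg
      h'.ratio_lt_one (C := C) ?_ ?_ ⟨hy, rfl⟩
    · rintro u _ ⟨hu, rfl⟩
      exact hC u (hL _ _ hu) _ h'.right_mem
    · rintro u v ⟨hu, rfl⟩
      obtain ⟨j, hj, a, b, hab, ha, rfl⟩ := hR _ _ hu
      obtain ⟨rfl, rfl⟩ := h.eq_of_map_eq_right hj (hK _ _ hab) ha
      refine Or.inr ⟨b, _, ⟨hab, rfl⟩, ?_⟩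
      simpa only [h'.map_right] using h'.dist_le _ hj b v
  have adjacent : ∀ j ∈ Icc 1 ℓ, j + 1 ∈ Icc 1 ℓ → ∀ a b c d, R a b → R c d →
      φ j a = φ (j + 1) c → ψ j b = ψ (j + 1) d := by
    intro j hj hj' a b c d hab hcd he
    obtain ⟨rfl, rfl⟩ := h.eq_of_adjacent j hj hj' a (hK _ _ hab) c (hK _ _ hcd) he
    rw [right _ hab, left _ hcd, h'.glue j hj hj']
  refine eq_of_bounded_expanding (P := fun u v => ∃ x, R x u ∧ R x v) h'.ratio_nonneg
    h'.ratio_lt_one (C := C) ?_ ?_ ⟨x, hy, hy'⟩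
  · rintro u v ⟨x, hu, hv⟩
    exact hC u (hL _ _ hu) v (hL _ _ hv)
  · rintro u v ⟨x, hu, hv⟩
    obtain ⟨i, hi, a, b, hab, rfl, rfl⟩ := hR _ _ hu
    obtain ⟨j, hj, c, d, hcd, he, rfl⟩ := hR _ _ hv
    obtain rfl | rfl | rfl | hij | hij :
        i = j ∨ j = i + 1 ∨ i = j + 1 ∨ i + 1 < j ∨ j + 1 < i := by omega
    · obtain rfl := h.injective _ hi he
      exact Or.inr ⟨b, d, ⟨c, hab, hcd⟩, h'.dist_le _ hi b d⟩
    · exact Or.inl (adjacent i hi hj a b c d hab hcd he.symm)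
    · exact Or.inl (adjacent j hj hi c d a b hcd hab he).symm
    · exact absurd he.symm (h.ne_of_far i hi j hj hij a (hK _ _ hab) c (hK _ _ hcd))
    · exact absurd he (h.ne_of_far j hj i hi hij c (hK _ _ hcd) a (hK _ _ hab))

/-- The orbit of the pair of left endpoints under the maps `Prod.map (φ j) (ψ j)`. -/
inductive Orbit (ℓ : ℕ) (φ : ℕ → X → X) (ψ : ℕ → Y → Y) (p : X) (p' : Y) : X × Y → Prop
  | base : Orbit ℓ φ ψ p p' (p, p')
  | step (j : ℕ) (hj : j ∈ Icc 1 ℓ) (z : X × Y) (hz : Orbit ℓ φ ψ p p' z) :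
      Orbit ℓ φ ψ p p' (Prod.map (φ j) (ψ j) z)

/-- The attractors of two chains of the same length are homeomorphic. -/
theorem nonempty_homeomorph (h : IsContractionChain ℓ r φ K p q)
    (h' : IsContractionChain ℓ s ψ L p' q') : Nonempty (K ≃ₜ L) := by
  set O : Set (X × Y) := {z | Orbit ℓ φ ψ p p' z}
  set G : Set (X × Y) := closure O
  have hcont : ∀ j ∈ Icc 1 ℓ, Continuous (Prod.map (φ j) (ψ j)) := fun j hj =>
    (h.continuous hj).prodMap (h'.continuous hj)
  have hOKL : O ⊆ K ×ˢ L := by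
    intro z hz
    induction hz with
    | base => exact ⟨h.left_mem, h'.left_mem⟩
    | step j hj z _ ih => exact ⟨h.mapsTo j hj ih.1, h'.mapsTo j hj ih.2⟩
  have hKL : IsCompact (K ×ˢ L) := h.isCompact.prod h'.isCompact
  have hGKL : G ⊆ K ×ˢ L := closure_minimal hOKL hKL.isClosed
  have hGc : IsCompact G := hKL.of_isClosed_subset isClosed_closure hGKL
  have hbase : (p, p') ∈ G := subset_closure Orbit.base
  have hfwd : ∀ j ∈ Icc 1 ℓ, MapsTo (Prod.map (φ j) (ψ j)) G G := fun j hj =>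
    MapsTo.closure (fun z hz => Orbit.step j hj z hz) (hcont j hj)
  have hback : G ⊆ ⋃ j ∈ Icc 1 ℓ, Prod.map (φ j) (ψ j) '' G := by
    refine closure_minimal ?_
      ((finite_Icc 1 ℓ).isCompact_biUnion fun j hj => hGc.image (hcont j hj)).isClosed
    intro z hz
    simp only [mem_iUnion]
    cases hz with
    | base => exact ⟨1, h.one_mem, (p, p'), hbase, Prod.ext h.map_left h'.map_left⟩
    | step j hj z hz => exact ⟨j, hj, z, subset_closure hz, rfl⟩
  have hback' : ∀ x y, (x, y) ∈ G → ∃ j ∈ Icc 1 ℓ, ∃ a b, (a, b) ∈ G ∧ φ j a = x ∧ ψ j b = y := by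
    intro x y hxy
    have := hback hxy
    simp only [mem_iUnion] at this
    obtain ⟨j, hj, ⟨a, b⟩, hab, he⟩ := this
    exact ⟨j, hj, a, b, hab, congrArg Prod.fst he, congrArg Prod.snd he⟩
  have hsurj₁ : K ⊆ Prod.fst '' G :=
    h.subset_of_mapsTo (hGc.image continuous_fst).isClosed ⟨_, hbase, rfl⟩ fun j hj => by
      rintro _ ⟨z, hz, rfl⟩
      exact ⟨_, hfwd j hj hz, rfl⟩
  have hsurj₂ : L ⊆ Prod.snd '' G :=
    h'.subset_of_mapsTo (hGc.image continuous_snd).isClosed ⟨_, hbase, rfl⟩ fun j hj => by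
      rintro _ ⟨z, hz, rfl⟩
      exact ⟨_, hfwd j hj hz, rfl⟩
  have : CompactSpace G := isCompact_iff_compactSpace.1 hGc
  let f : G → K := fun z => ⟨z.1.1, (hGKL z.2).1⟩
  let g : G → L := fun z => ⟨z.1.2, (hGKL z.2).2⟩
  have hf : Function.Bijective f := by
    constructor
    · rintro ⟨⟨x, y⟩, hz⟩ ⟨⟨x', y'⟩, hz'⟩ he
      obtain rfl : x = x' := congrArg Subtype.val he
      obtain rfl : y = y' := h.right_unique_of_compatible h' (R := fun x y => (x, y) ∈ G)
        (fun _ _ hxy => (hGKL hxy).1) (fun _ _ hxy => (hGKL hxy).2) hback' hz hz'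
      rfl
    · rintro ⟨x, hx⟩
      obtain ⟨z, hz, rfl⟩ := hsurj₁ hx
      exact ⟨⟨z, hz⟩, rfl⟩
  have hg : Function.Bijective g := by
    constructor
    · rintro ⟨⟨x, y⟩, hz⟩ ⟨⟨x', y'⟩, hz'⟩ he
      obtain rfl : y = y' := congrArg Subtype.val he
      obtain rfl : x = x' := h'.right_unique_of_compatible h (R := fun y x => (x, y) ∈ G)
        (fun _ _ hxy => (hGKL hxy).2) (fun _ _ hxy => (hGKL hxy).1)
        (fun y x hxy => by
          obtain ⟨j, hj, a, b, hab, ha, hb⟩ := hback' x y hxy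
          exact ⟨j, hj, b, a, hab, hb, ha⟩) hz hz'
      rfl
    · rintro ⟨y, hy⟩
      obtain ⟨z, hz, rfl⟩ := hsurj₂ hy
      exact ⟨⟨z, hz⟩, rfl⟩
  have hfc : Continuous f := (continuous_fst.comp continuous_subtype_val).subtype_mk _
  have hgc : Continuous g := (continuous_snd.comp continuous_subtype_val).subtype_mk _
  have e₁ : G ≃ₜ K := Continuous.homeoOfEquivCompactToT2 (f := Equiv.ofBijective f hf) hfc
  have e₂ : G ≃ₜ L := Continuous.homeoOfEquivCompactToT2 (f := Equiv.ofBijective g hg) hgc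
  exact ⟨e₁.symm.trans e₂⟩

end IsContractionChain

/-- The unit interval is the attractor of the chain of its `ℓ` subintervals of equal length. -/
lemma isContractionChain_unitInterval {ℓ : ℕ} (hℓ : 2 ≤ ℓ) :
    IsContractionChain ℓ (1 / ℓ : ℝ) (fun j (t : ℝ) => (t + (j - 1)) / ℓ) (Icc 0 1) 0 1 := by
  have hℓ2 : (2 : ℝ) ≤ ℓ := by exact_mod_cast hℓ
  have hℓ0 : (0 : ℝ) < ℓ := by linarith
  refine
    { one_le := by omega
      ratio_nonneg := by positivity
      ratio_lt_one := by rw [div_lt_one hℓ0]; linarith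
      isCompact := isCompact_Icc
      left_mem := by simp
      right_mem := by simp
      left_ne_right := zero_ne_one
      dist_le := ?_
      injective := ?_
      mapsTo := ?_
      cover := ?_
      map_left := by simp
      map_right := by field_simp; ring
      glue := ?_
      eq_of_adjacent := ?_
      ne_of_far := ?_ }
  · intro j _ x y
    rw [Real.dist_eq, Real.dist_eq, ← sub_div, abs_div, abs_of_pos hℓ0]
    apply le_of_eq
    ring_nf
  · intro j _ x y he
    simpa [div_left_inj' hℓ0.ne'] using he
  · rintro j ⟨hj1, hj2⟩ x ⟨hx0, hx1⟩
    have h1 : (1 : ℝ) ≤ j := by exact_mod_cast hj1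
    have h2 : (j : ℝ) ≤ ℓ := by exact_mod_cast hj2
    refine ⟨div_nonneg (by linarith) hℓ0.le, ?_⟩
    rw [div_le_one hℓ0]
    linarith
  · rintro x ⟨hx0, hx1⟩
    rcases hx0.eq_or_lt with rfl | hx0
    · exact ⟨1, ⟨le_rfl, by omega⟩, 0, by simp, by simp⟩
    have hpos : 0 < ℓ * x := by positivity
    refine ⟨⌈ℓ * x⌉₊, ⟨Nat.ceil_pos.2 hpos, Nat.ceil_le.2 ?_⟩, ℓ * x - (⌈ℓ * x⌉₊ - 1), ⟨?_, ?_⟩, ?_⟩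
    · nlinarith
    · linarith [Nat.ceil_lt_add_one hpos.le]
    · linarith [Nat.le_ceil (ℓ * x)]
    · field_simp
      ring
  · intro j _ _
    push_cast
    ring
  · rintro j _ _ x ⟨_, hx1⟩ y ⟨hy0, _⟩ he
    push_cast at he
    rw [div_left_inj' hℓ0.ne'] at he
    constructor <;> linarith
  · rintro i _ j _ hij x ⟨_, hx1⟩ y ⟨hy0, _⟩ he
    rw [div_left_inj' hℓ0.ne'] at he
    have : (i : ℝ) + 1 + 1 ≤ j := by exact_mod_cast hij
    linarith

theorem stmt6
    (ℓ : ℕ) (hℓ : 2 ≤ ℓ) (z : ℕ → ℂ) (hz0 : z 0 = 0) (hzl : z ℓ = 1)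
    (b : ℕ → ℂ) (hb : ∀ j, 1 ≤ j → j ≤ ℓ → b j = z j - z (j - 1))
    (hb01 : ∀ j, 1 ≤ j → j ≤ ℓ → 0 < ‖b j‖ ∧ ‖b j‖ < 1)
    (S : ℕ → ℂ → ℂ) (hS : ∀ j w, S j w = b j * w + z (j - 1))
    (Λ : Set ℂ) (hne : Λ.Nonempty) (hcomp : IsCompact Λ)
    (hinv : Λ = ⋃ j ∈ Finset.Icc 1 ℓ, S j '' Λ)
    (hdisj : ∀ i j, 1 ≤ i → i ≤ ℓ → 1 ≤ j → j ≤ ℓ → (i + 1 < j ∨ j + 1 < i) →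
      Disjoint (S i '' Λ) (S j '' Λ))
    (hsing : ∀ j, 1 ≤ j → j ≤ ℓ - 1 → S j '' Λ ∩ S (j + 1) '' Λ = {z j}) :
    Nonempty (Set.Icc (0:ℝ) 1 ≃ₜ Λ) := by
  have hb0 : ∀ j ∈ Icc 1 ℓ, b j ≠ 0 := fun j hj => norm_pos_iff.1 (hb01 j hj.1 hj.2).1
  have hSinj : ∀ j ∈ Icc 1 ℓ, Function.Injective (S j) := by
    intro j hj x y he
    rw [hS, hS] at he
    exact mul_left_cancel₀ (hb0 j hj) (add_right_cancel he)
  have hS0 : ∀ j, S (j + 1) 0 = z j := fun j => by simp [hS]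
  have hS1 : ∀ j ∈ Icc 1 ℓ, S j 1 = z j := fun j hj => by
    rw [hS, hb j hj.1 hj.2]
    ring
  have hmeet : ∀ j ∈ Icc 1 ℓ, j + 1 ∈ Icc 1 ℓ → S j '' Λ ∩ S (j + 1) '' Λ = {z j} :=
    fun j hj hj' => hsing j hj.1 (by have := hj'.2; omega)
  have h1mem : 1 ∈ Icc 1 ℓ := ⟨le_rfl, by omega⟩
  have h2mem : 1 + 1 ∈ Icc 1 ℓ := ⟨by omega, by omega⟩
  obtain ⟨⟨u, hu, hu'⟩, v, hv, hv'⟩ :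
      z 1 ∈ S 1 '' Λ ∩ S (1 + 1) '' Λ := by
    rw [hmeet 1 h1mem h2mem]
    rfl
  obtain rfl : u = 1 := hSinj 1 h1mem (hu'.trans (hS1 1 h1mem).symm)
  obtain rfl : v = 0 := hSinj _ h2mem (hv'.trans (hS0 1).symm)
  obtain ⟨k, hk, hmax⟩ := Finset.exists_max_image (Finset.Icc 1 ℓ) (fun j => ‖b j‖)
    ⟨1, Finset.mem_Icc.2 h1mem⟩
  have hΛ : IsContractionChain ℓ ‖b k‖ S Λ 0 1 :=
    { one_le := by omega
      ratio_nonneg := norm_nonneg _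
      ratio_lt_one := (hb01 k (Finset.mem_Icc.1 hk).1 (Finset.mem_Icc.1 hk).2).2
      isCompact := hcomp
      left_mem := hv
      right_mem := hu
      left_ne_right := zero_ne_one
      dist_le := by
        intro j hj x y
        rw [dist_eq_norm, dist_eq_norm, hS, hS, add_sub_add_right_eq_sub, ← mul_sub, norm_mul]
        gcongr
        exact hmax j (Finset.mem_Icc.2 hj)
      injective := hSinj
      mapsTo := by
        intro j hj x hx
        rw [hinv]
        exact mem_biUnion (Finset.mem_Icc.2 hj) ⟨x, hx, rfl⟩
      cover := by
        intro x hx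
        rw [hinv] at hx
        simp only [mem_iUnion] at hx
        obtain ⟨j, hj, y, hy, he⟩ := hx
        exact ⟨j, Finset.mem_Icc.1 hj, y, hy, he⟩
      map_left := (hS0 0).trans hz0
      map_right := (hS1 ℓ ⟨by omega, le_rfl⟩).trans hzl
      glue := fun j hj _ => (hS1 j hj).trans (hS0 j).symm
      eq_of_adjacent := by
        intro j hj hj' x hx y hy he
        have hm : S j x ∈ S j '' Λ ∩ S (j + 1) '' Λ := ⟨⟨x, hx, rfl⟩, y, hy, he.symm⟩
        rw [hmeet j hj hj', mem_singleton_iff] at hm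
        exact ⟨hSinj j hj (hm.trans (hS1 j hj).symm),
          hSinj _ hj' ((he.symm.trans hm).trans (hS0 j).symm)⟩
      ne_of_far := by
        intro i hi j hj hij x hx y hy
        exact (hdisj i j hi.1 hi.2 hj.1 hj.2 (Or.inl hij)).ne_of_mem ⟨x, hx, rfl⟩ ⟨y, hy, rfl⟩ }
  exact (isContractionChain_unitInterval hℓ).nonempty_homeomorph hΛ
end
end

section
/- Let α, β > 0 be real numbers, let λ, μ ∈ (0,1), let t ≥ 1 be real, and set x = −log λ, y = −log μ, and u = log(α/β). Then the following are equivalent: (1) there exists a constant C > 0 such that (λ^j + μ^k)^t ≤ C|αλ^j − βμ^k| for all integers j, k ≥ 0; (2) there exists a constant M > 0 such that e^{−j(t−1)x} ≤ M|u − jx + ky| for all integers j, k ≥ 0. -/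
open MeasureTheory Set Filter

noncomputable section

theorem mul_log_sub_log_le {A B : ℝ} (hA : 0 < A) (hB : 0 < B) :
    B * (Real.log A - Real.log B) ≤ A - B := by
  have h := Real.log_le_sub_one_of_pos (div_pos hA hB)
  rw [Real.log_div hA.ne' hB.ne'] at h
  calc B * (Real.log A - Real.log B) ≤ B * (A / B - 1) := by gcongr
    _ = A - B := by field_simp

theorem abs_sub_le_add_mul_abs_log_sub_log {A B : ℝ} (hA : 0 < A) (hB : 0 < B) :
    |A - B| ≤ (A + B) * |Real.log A - Real.log B| := by
  have h₁ := mul_log_sub_log_le hA hB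
  have h₂ := mul_log_sub_log_le hB hA
  have hle := le_abs_self (Real.log A - Real.log B)
  have hneg := neg_le_abs (Real.log A - Real.log B)
  have habs := abs_nonneg (Real.log A - Real.log B)
  rw [abs_le]
  constructor <;> nlinarith

theorem le_three_mul_of_log_sub_log_le_one {A B : ℝ} (hA : 0 < A) (hB : 0 < B)
    (h : Real.log A - Real.log B ≤ 1) : A ≤ 3 * B := by
  have hlog : Real.log A ≤ Real.log (Real.exp 1 * B) := by
    rw [Real.log_mul (Real.exp_pos 1).ne' hB.ne', Real.log_exp]
    linarith
  have hle := (Real.log_le_log_iff hA (by positivity)).1 hlog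
  nlinarith [Real.exp_one_lt_d9]

theorem two_mul_le_of_one_le_log_sub_log {A B : ℝ} (hA : 0 < A) (hB : 0 < B)
    (h : 1 ≤ Real.log A - Real.log B) : 2 * B ≤ A := by
  have := mul_log_sub_log_le hA hB
  nlinarith

theorem mul_abs_log_sub_log_le_three_mul_abs_sub {A B : ℝ} (hA : 0 < A) (hB : 0 < B)
    (h : |Real.log A - Real.log B| ≤ 1) :
    A * |Real.log A - Real.log B| ≤ 3 * |A - B| := by
  rcases le_total B A with hBA | hAB
  · have hlog := Real.log_le_log hB hBA
    rw [abs_of_nonneg (sub_nonneg.2 hlog)] at h ⊢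
    rw [abs_of_nonneg (sub_nonneg.2 hBA)]
    have := le_three_mul_of_log_sub_log_le_one hA hB h
    nlinarith [mul_log_sub_log_le hA hB]
  · have hlog := Real.log_le_log hA hAB
    rw [abs_of_nonpos (sub_nonpos.2 hlog), abs_of_nonpos (sub_nonpos.2 hAB)]
    nlinarith [mul_log_sub_log_le hB hA]

theorem add_le_four_mul_abs_sub_of_one_le_abs_log_sub_log {A B : ℝ} (hA : 0 < A) (hB : 0 < B)
    (h : 1 ≤ |Real.log A - Real.log B|) : A + B ≤ 4 * |A - B| := by
  rcases le_abs.1 h with h | h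
  · have := two_mul_le_of_one_le_log_sub_log hA hB h
    linarith [le_abs_self (A - B)]
  · have := two_mul_le_of_one_le_log_sub_log hB hA (by linarith)
    linarith [neg_le_abs (A - B)]

theorem rpow_sub_one_le_of_add_rpow_le {a c P Q t C : ℝ} (ha : 0 < a) (hc : 0 < c)
    (hP : 0 < P) (hQ : 0 < Q) (ht : 1 ≤ t) (hC : 0 < C)
    (h : (P + Q) ^ t ≤ C * |a * P - c * Q|) :
    P ^ (t - 1) ≤ C * (a + c) * |Real.log (a * P) - Real.log (c * Q)| := by
  set D := |Real.log (a * P) - Real.log (c * Q)|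
  have hPQ : 0 < P + Q := by positivity
  have hD : 0 ≤ D := abs_nonneg _
  have hsub : |a * P - c * Q| ≤ (a * P + c * Q) * D :=
    abs_sub_le_add_mul_abs_log_sub_log (by positivity) (by positivity)
  have hmax : a * P + c * Q ≤ (a + c) * (P + Q) := by nlinarith [mul_pos ha hQ, mul_pos hc hP]
  calc P ^ (t - 1) ≤ (P + Q) ^ (t - 1) := by
        exact Real.rpow_le_rpow hP.le (by linarith) (by linarith)
    _ = (P + Q) ^ t / (P + Q) := Real.rpow_sub_one hPQ.ne' t
    _ ≤ C * (((a + c) * (P + Q)) * D) / (P + Q) := by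
        gcongr
        exact h.trans (by gcongr; exact hsub.trans (by gcongr))
    _ = C * (a + c) * D := by field_simp

theorem add_rpow_le_of_rpow_sub_one_le {a c P Q t M : ℝ} (ha : 0 < a) (hc : 0 < c)
    (hP : 0 < P) (hQ : 0 < Q) (hP1 : P ≤ 1) (hQ1 : Q ≤ 1) (ht : 1 ≤ t) (hM : 0 < M)
    (h : P ^ (t - 1) ≤ M * |Real.log (a * P) - Real.log (c * Q)|) :
    (P + Q) ^ t ≤ ((1 + 3 * a / c) ^ t * (3 * M / a) + 2 ^ (t - 1) * (4 * (1 / a + 1 / c))) *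
      |a * P - c * Q| := by
  have hA : 0 < a * P := by positivity
  have hB : 0 < c * Q := by positivity
  have hPQ : 0 < P + Q := by positivity
  rw [add_mul]
  rcases le_total |Real.log (a * P) - Real.log (c * Q)| 1 with hD | hD
  · refine le_add_of_le_of_nonneg ?_ (by positivity)
    have hsub := mul_abs_log_sub_log_le_three_mul_abs_sub hA hB hD
    have hBA : c * Q ≤ 3 * (a * P) :=
      le_three_mul_of_log_sub_log_le_one hB hA
        (by linarith [neg_le_abs (Real.log (a * P) - Real.log (c * Q))])
    have hQP : Q ≤ 3 * a / c * P := by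
      rw [div_mul_eq_mul_div, le_div_iff₀ hc]
      linarith
    have hPt : P ^ t ≤ 3 * M / a * |a * P - c * Q| := by
      calc P ^ t = P * P ^ (t - 1) := by rw [Real.rpow_sub_one hP.ne']; field_simp
        _ ≤ P * (M * |Real.log (a * P) - Real.log (c * Q)|) := by gcongr
        _ = M / a * (a * P * |Real.log (a * P) - Real.log (c * Q)|) := by field_simp
        _ ≤ M / a * (3 * |a * P - c * Q|) := by gcongr
        _ = 3 * M / a * |a * P - c * Q| := by ring
    calc (P + Q) ^ t ≤ ((1 + 3 * a / c) * P) ^ t := by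
          exact Real.rpow_le_rpow hPQ.le (by linarith) (by linarith)
      _ = (1 + 3 * a / c) ^ t * P ^ t := Real.mul_rpow (by positivity) hP.le
      _ ≤ (1 + 3 * a / c) ^ t * (3 * M / a * |a * P - c * Q|) := by gcongr
      _ = _ := by ring
  · refine le_add_of_nonneg_of_le (by positivity) ?_
    have hsub := add_le_four_mul_abs_sub_of_one_le_abs_log_sub_log hA hB hD
    have hsum : P + Q ≤ (1 / a + 1 / c) * (a * P + c * Q) := by
      have : (1 / a + 1 / c) * (a * P + c * Q) = P + Q + (c * Q / a + a * P / c) := by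
        field_simp
        ring
      rw [this]
      exact le_add_of_nonneg_right (by positivity)
    calc (P + Q) ^ t = (P + Q) ^ (t - 1) * (P + Q) := by
          rw [Real.rpow_sub_one hPQ.ne']; field_simp
      _ ≤ 2 ^ (t - 1) * ((1 / a + 1 / c) * (4 * |a * P - c * Q|)) := by
          gcongr
          · linarith
          · exact hsum.trans (by gcongr)
      _ = _ := by ring

theorem stmt13 (a c lam mu t : ℝ) (ha : 0 < a) (hc : 0 < c)
    (hlam : lam ∈ Set.Ioo (0:ℝ) 1) (hmu : mu ∈ Set.Ioo (0:ℝ) 1) (ht : 1 ≤ t)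
    (x y u : ℝ) (hx : x = -Real.log lam) (hy : y = -Real.log mu)
    (hu : u = Real.log (a / c)) :
    (∃ C > (0:ℝ), ∀ j k : ℕ, (lam ^ j + mu ^ k) ^ t ≤ C * |a * lam ^ j - c * mu ^ k|) ↔
    (∃ M > (0:ℝ), ∀ j k : ℕ, Real.exp (-(j : ℝ) * (t - 1) * x) ≤ M * |u - j * x + k * y|) := by
  have hP (j : ℕ) : 0 < lam ^ j := pow_pos hlam.1 j
  have hQ (k : ℕ) : 0 < mu ^ k := pow_pos hmu.1 k
  have hexp (j : ℕ) : Real.exp (-(j : ℝ) * (t - 1) * x) = (lam ^ j) ^ (t - 1) := by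
    rw [Real.rpow_def_of_pos (hP j), Real.log_pow, hx]
    ring_nf
  have hlog (j k : ℕ) :
      u - j * x + k * y = Real.log (a * lam ^ j) - Real.log (c * mu ^ k) := by
    rw [Real.log_mul ha.ne' (hP j).ne', Real.log_mul hc.ne' (hQ k).ne', Real.log_pow,
      Real.log_pow, hu, hx, hy, Real.log_div ha.ne' hc.ne']
    ring
  simp only [hexp, hlog]
  constructor
  · rintro ⟨C, hC, h⟩
    exact ⟨C * (a + c), by positivity, fun j k =>
      rpow_sub_one_le_of_add_rpow_le ha hc (hP j) (hQ k) ht hC (h j k)⟩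
  · rintro ⟨M, hM, h⟩
    exact ⟨_, by positivity, fun j k =>
      add_rpow_le_of_rpow_sub_one_le ha hc (hP j) (hQ k) (pow_le_one₀ hlam.1.le hlam.2.le)
        (pow_le_one₀ hmu.1.le hmu.2.le) ht hM (h j k)⟩
end
end

section
/- Let a₀ > 0 be a real number and let ν be a positive integer. Then there exists a transcendental real number τ with 1 < τ < 1 + 2^{−ν} such that τ has approximation property J_{a₀}, but τ does not have approximation property J_a for any a with 0 < a < a₀. -/
open MeasureTheory Set Filter

noncomputable section

def HasApproxJ (τ a : ℝ) : Prop :=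
  ∃ C > (0:ℝ), ∀ (k : ℤ) (j : ℕ), 0 < j → C * (j : ℝ)⁻¹ * Real.exp (-a * j) ≤ |τ - k / j|

/-- A sequence of exponents `m` such that `2 ^ m (n + 1)` agrees with `exp (a * 2 ^ m n)` up to a
factor of two. -/
theorem exists_exponents_exp (a : ℝ) (ha : 0 < a) (N : ℕ) :
    ∃ m : ℕ → ℕ, N ≤ m 0 ∧ ∀ n, 2 * m n + 4 ≤ m (n + 1) ∧
      (2 : ℝ) ^ m (n + 1) ≤ Real.exp (a * 2 ^ m n) ∧
      Real.exp (a * 2 ^ m n) < 2 * 2 ^ m (n + 1) := by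
  have hlog : 0 < Real.log 2 := Real.log_pos one_lt_two
  have hev : ∀ᶠ k : ℕ in atTop, 2 * k + 4 ≤ ⌊a * 2 ^ k / Real.log 2⌋₊ := by
    have h1 : Tendsto (fun k : ℕ => (k : ℝ) ^ 1 / (2 : ℝ) ^ k) atTop (nhds 0) :=
      tendsto_pow_const_div_const_pow_of_one_lt 1 one_lt_two
    have hc : 0 < a / Real.log 2 / 6 := by positivity
    filter_upwards [h1.eventually (gt_mem_nhds hc), eventually_ge_atTop 1] with k hk hk1
    rw [pow_one, div_lt_iff₀ (by positivity)] at hk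
    apply Nat.le_floor
    have hk1' : (1 : ℝ) ≤ k := by exact_mod_cast hk1
    have : a * 2 ^ k / Real.log 2 = 6 * (a / Real.log 2 / 6 * 2 ^ k) := by ring
    rw [this]
    push_cast
    linarith
  obtain ⟨M, hM⟩ := eventually_atTop.1 hev
  let f : ℕ → ℕ := fun k => ⌊a * 2 ^ k / Real.log 2⌋₊
  let m : ℕ → ℕ := fun n => f^[n] (max M N)
  have hsucc : ∀ n, m (n + 1) = f (m n) := fun n => Function.iterate_succ_apply' f n _
  have hge : ∀ n, M ≤ m n := by
    intro n
    induction n with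
    | zero => exact le_max_left _ _
    | succ n ih =>
      have h2 : 2 * m n + 4 ≤ f (m n) := hM (m n) ih
      rw [hsucc]
      omega
  have hexp : ∀ k : ℕ, Real.exp (a * 2 ^ k) = (2 : ℝ) ^ (a * 2 ^ k / Real.log 2) := by
    intro k
    rw [Real.rpow_def_of_pos two_pos]
    congr 1
    field_simp
  refine ⟨m, le_max_right _ _, fun n => ⟨?_, ?_, ?_⟩⟩
  · rw [hsucc]
    exact hM (m n) (hge n)
  · rw [hsucc, hexp, ← Real.rpow_natCast]
    exact Real.rpow_le_rpow_of_exponent_le one_le_two (Nat.floor_le (by positivity))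
  · rw [hsucc, hexp, ← pow_succ', ← Real.rpow_natCast 2 (f (m n) + 1)]
    apply Real.rpow_lt_rpow_of_exponent_lt one_lt_two
    push_cast
    exact Nat.lt_floor_add_one _

/-- Partial sums of a sparse dyadic series are fractions with odd numerator. -/
theorem exists_odd_partial_sum (m : ℕ → ℕ) (h0 : 1 ≤ m 0) (hm : StrictMono m) (n : ℕ) :
    ∃ p : ℤ, Odd p ∧
      1 + ∑ i ∈ Finset.range (n + 1), (1 / 2 : ℝ) ^ m i = p / ((2 ^ m n : ℕ) : ℝ) := by
  induction n with
  | zero =>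
    refine ⟨2 ^ m 0 + 1, Even.add_one ((even_two).pow_of_ne_zero (by omega)), ?_⟩
    simp only [zero_add, Finset.sum_range_one, one_div, inv_pow]
    push_cast
    field_simp
  | succ n ih =>
    obtain ⟨p, -, hp⟩ := ih
    have hlt : m n < m (n + 1) := hm n.lt_succ_self
    obtain ⟨d, hd⟩ := Nat.exists_eq_add_of_lt hlt
    refine ⟨p * 2 ^ (d + 1) + 1,
      Even.add_one (Even.mul_left ((even_two).pow_of_ne_zero (by omega)) _), ?_⟩
    rw [Finset.sum_range_succ, ← add_assoc, hp, hd, one_div, inv_pow]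
    push_cast
    rw [add_assoc, pow_add 2 (m n)]
    field_simp

/-- The tail of a dyadic series with strictly increasing exponents is comparable to its leading
term. -/
theorem dyadic_tail_bounds (m : ℕ → ℕ) (hm : StrictMono m) (n : ℕ) :
    (1 / 2 : ℝ) ^ m n + ∑ i ∈ Finset.range n, (1 / 2 : ℝ) ^ m i ≤ ∑' i, (1 / 2 : ℝ) ^ m i ∧
      ∑' i, (1 / 2 : ℝ) ^ m i ≤
        2 * (1 / 2 : ℝ) ^ m n + ∑ i ∈ Finset.range n, (1 / 2 : ℝ) ^ m i := by
  have hadd : ∀ i, m n + i ≤ m (i + n) := by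
    intro i
    induction i with
    | zero => simp
    | succ i ih =>
      have : m (i + n) < m (i + 1 + n) := hm (by omega)
      omega
  have hle : ∀ i, (1 / 2 : ℝ) ^ m (i + n) ≤ (1 / 2 : ℝ) ^ m n * (1 / 2) ^ i := by
    intro i
    rw [← pow_add]
    exact pow_le_pow_of_le_one (by norm_num) (by norm_num) (hadd i)
  have hgeo : HasSum (fun i : ℕ => (1 / 2 : ℝ) ^ m n * (1 / 2) ^ i) ((1 / 2 : ℝ) ^ m n * 2) :=
    hasSum_geometric_two.mul_left _
  have hs : Summable (fun i => (1 / 2 : ℝ) ^ m (i + n)) :=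
    Summable.of_nonneg_of_le (fun _ => by positivity) hle hgeo.summable
  have hs' : Summable (fun i => (1 / 2 : ℝ) ^ m i) :=
    (summable_nat_add_iff n).1 hs
  rw [← hs'.sum_add_tsum_nat_add n]
  have h1 : (1 / 2 : ℝ) ^ m (0 + n) ≤ ∑' i, (1 / 2 : ℝ) ^ m (i + n) :=
    hs.le_tsum 0 (fun _ _ => by positivity)
  have h2 : ∑' i, (1 / 2 : ℝ) ^ m (i + n) ≤ (1 / 2 : ℝ) ^ m n * 2 := by
    rw [← hgeo.tsum_eq]
    exact hs.tsum_le_tsum hle hgeo.summable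
  rw [zero_add] at h1
  constructor <;> linarith

/-- Distinct fractions are separated by the reciprocal of the product of the denominators. -/
theorem inv_mul_le_abs_div_sub_div (p k : ℤ) (q j : ℕ) (hq : 0 < q) (hj : 0 < j)
    (hne : p * j ≠ k * q) : 1 / ((j : ℝ) * q) ≤ |(p : ℝ) / q - k / j| := by
  have hq' : (0 : ℝ) < q := by exact_mod_cast hq
  have hj' : (0 : ℝ) < j := by exact_mod_cast hj
  have h1 : (1 : ℝ) ≤ |(p * j - k * q : ℝ)| := by
    have := Int.one_le_abs (sub_ne_zero.2 hne)
    exact_mod_cast this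
  have h2 : (p : ℝ) / q - k / j = (p * j - k * q) / (j * q) := by
    field_simp
  rw [h2, abs_div, abs_of_pos (by positivity : (0 : ℝ) < j * q)]
  gcongr

/-- A real number with odd-over-power-of-two approximants `p n / q n`, whose denominators grow like
iterated exponentials with rate `a`, has property `J_a`. -/
theorem hasApproxJ_of_approximants {τ a : ℝ} (ha : 0 < a) (p : ℕ → ℤ) (q : ℕ → ℕ)
    (hq0 : ∀ n, 0 < q n) (hcop : ∀ n, IsCoprime (p n) (q n : ℤ))
    (hgrow : ∀ n, 16 * q n ^ 2 ≤ q (n + 1))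
    (hexp : ∀ n, (q (n + 1) : ℝ) ≤ Real.exp (a * q n))
    (hlow : ∀ n, 1 / (q (n + 1) : ℝ) ≤ τ - p n / q n)
    (hup : ∀ n, τ - p n / q n ≤ 2 / (q (n + 1) : ℝ)) : HasApproxJ τ a := by
  have hmono : StrictMono q := by
    apply strictMono_nat_of_lt_succ
    intro n
    nlinarith [hgrow n, hq0 n]
  have hq0' : ∀ n, (0 : ℝ) < q n := fun n => by exact_mod_cast hq0 n
  refine ⟨min 1 (min (1 / (2 * (q 0 : ℝ))) (a ^ 2 / 4)), ?_, ?_⟩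
  · have := hq0' 0
    positivity
  intro k j hj
  set C := min 1 (min (1 / (2 * (q 0 : ℝ))) (a ^ 2 / 4)) with hC
  have hC1 : C ≤ 1 := min_le_left _ _
  have hC2 : C ≤ 1 / (2 * (q 0 : ℝ)) := (min_le_right _ _).trans (min_le_left _ _)
  have hC3 : C ≤ a ^ 2 / 4 := (min_le_right _ _).trans (min_le_right _ _)
  have hj' : (1 : ℝ) ≤ j := by exact_mod_cast hj
  have hj0 : (0 : ℝ) < j := by linarith
  have hex : ∃ n, 4 * j * q n ≤ q (n + 1) := by
    refine ⟨j, ?_⟩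
    have := hmono.le_apply (x := j)
    nlinarith [hgrow j, hq0 j]
  classical
  obtain ⟨n, hn, hmin⟩ : ∃ n, 4 * j * q n ≤ q (n + 1) ∧ ∀ i < n, ¬ 4 * j * q i ≤ q (i + 1) :=
    ⟨Nat.find hex, Nat.find_spec hex, fun i hi => Nat.find_min hex hi⟩
  have hqn := hq0' n
  have hqn1 := hq0' (n + 1)
  have hCJ : C * (j : ℝ)⁻¹ * Real.exp (-a * j) = C * Real.exp (-a * j) / j := by ring
  rw [hCJ, div_le_iff₀ hj0]
  by_cases heq : p n * j = k * q n
  · have hdvd : (q n : ℤ) ∣ j :=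
      (hcop n).symm.dvd_of_dvd_mul_left (Dvd.intro_left k heq.symm)
    have hle : q n ≤ j := Nat.le_of_dvd hj (by exact_mod_cast hdvd)
    have hle' : (q n : ℝ) ≤ j := by exact_mod_cast hle
    have hkj : (k : ℝ) / j = p n / q n := by
      rw [div_eq_div_iff hj0.ne' hqn.ne']
      exact_mod_cast heq.symm
    rw [hkj]
    have h1 : Real.exp (-a * j) ≤ |τ - p n / q n| := by
      calc Real.exp (-a * j) ≤ Real.exp (-(a * q n)) := by
            apply Real.exp_le_exp.2
            nlinarith
        _ = 1 / Real.exp (a * q n) := by rw [Real.exp_neg, one_div]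
        _ ≤ 1 / (q (n + 1) : ℝ) := one_div_le_one_div_of_le hqn1 (hexp n)
        _ ≤ τ - p n / q n := hlow n
        _ ≤ _ := le_abs_self _
    calc C * Real.exp (-a * j) ≤ 1 * |τ - p n / q n| := by gcongr
      _ = |τ - p n / q n| * 1 := by ring
      _ ≤ |τ - p n / q n| * j := by gcongr
  · have hsep := inv_mul_le_abs_div_sub_div (p n) k (q n) j (hq0 n) hj heq
    have htri : |(p n : ℝ) / q n - k / j| ≤ |τ - k / j| + 2 / (q (n + 1) : ℝ) := by
      have h1 : |τ - p n / q n| ≤ 2 / (q (n + 1) : ℝ) :=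
        abs_le.2 ⟨by have := hlow n; have : (0:ℝ) < 1 / (q (n + 1) : ℝ) := by positivity
                     have : (0:ℝ) < 2 / (q (n + 1) : ℝ) := by positivity
                     linarith, hup n⟩
      have h2 : (p n : ℝ) / q n - k / j = (τ - k / j) - (τ - p n / q n) := by ring
      rw [h2]
      exact (abs_sub _ _).trans (by gcongr)
    have htail : 2 / (q (n + 1) : ℝ) ≤ 1 / (2 * ((j : ℝ) * q n)) := by
      rw [div_le_div_iff₀ hqn1 (by positivity)]
      have : (4 * j * q n : ℝ) ≤ q (n + 1) := by exact_mod_cast hn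
      linarith
    have hhalf : 1 / ((j : ℝ) * q n) = 2 * (1 / (2 * ((j : ℝ) * q n))) := by
      field_simp
    have hmain : 1 / (2 * (q n : ℝ)) ≤ |τ - k / j| * j := by
      have h3 : 1 / (2 * ((j : ℝ) * q n)) ≤ |τ - k / j| := by linarith
      have h4 : 1 / (2 * (q n : ℝ)) = 1 / (2 * ((j : ℝ) * q n)) * j := by field_simp
      rw [h4]
      gcongr
    refine le_trans ?_ hmain
    have he1 : Real.exp (-a * j) ≤ 1 := Real.exp_le_one_iff.2 (by nlinarith)
    have hpos := Real.exp_pos (-a * j)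
    rcases n with _ | i
    · have : 0 < 1 / (2 * (q 0 : ℝ)) := by positivity
      nlinarith
    · have h5 : q (i + 1) < 4 * j * q i := not_le.1 (hmin i (Nat.lt_succ_self i))
      have h6 : 4 * q i < j := by
        have := hgrow i
        have := hq0 i
        by_contra hcon
        have : j * q i ≤ 4 * q i * q i := Nat.mul_le_mul_right _ (not_lt.1 hcon)
        nlinarith
      have h7 : q (i + 1) ≤ j ^ 2 := by nlinarith
      have h7' : (q (i + 1) : ℝ) ≤ (j : ℝ) ^ 2 := by exact_mod_cast h7
      have h8 : (a * j) ^ 2 / 2 ≤ Real.exp (a * j) := by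
        have := Real.quadratic_le_exp_of_nonneg (x := a * j) (by positivity)
        nlinarith [mul_pos ha hj0]
      rw [le_div_iff₀ (by positivity), neg_mul, Real.exp_neg]
      have hE := Real.exp_pos (a * j)
      rw [← div_eq_mul_inv, div_mul_eq_mul_div, div_le_one hE]
      calc C * (2 * (q (i + 1) : ℝ)) ≤ a ^ 2 / 4 * (2 * (j : ℝ) ^ 2) := by gcongr
        _ = (a * j) ^ 2 / 2 := by ring
        _ ≤ _ := h8

theorem stmt16 (a₀ : ℝ) (ha₀ : 0 < a₀) (ν : ℕ) (hν : 0 < ν) :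
    ∃ τ : ℝ, Transcendental ℚ τ ∧ 1 < τ ∧ τ < 1 + (1 / 2 : ℝ) ^ ν ∧
      HasApproxJ τ a₀ ∧ ∀ a : ℝ, 0 < a → a < a₀ → ¬ HasApproxJ τ a := by
  obtain ⟨m, hm0, hm⟩ := exists_exponents_exp a₀ ha₀ (ν + 2)
  have hmono : StrictMono m := strictMono_nat_of_lt_succ fun n => by
    have := (hm n).1
    omega
  choose p hodd hp using exists_odd_partial_sum m (by omega) hmono
  set q : ℕ → ℕ := fun n => 2 ^ m n with hq
  have hqr : ∀ n, (1 / 2 : ℝ) ^ m n = 1 / (q n : ℝ) := fun n => by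
    simp [hq]
  have hq0 : ∀ n, 0 < q n := fun n => by positivity
  have hq0' : ∀ n, (0 : ℝ) < q n := fun n => by exact_mod_cast hq0 n
  have hqmono : StrictMono q := fun x y h => Nat.pow_lt_pow_right (by norm_num) (hmono h)
  have hq1 : ∀ n, 1 < q n := fun n => by
    have h1 : q 0 ≤ q n := hqmono.monotone (Nat.zero_le n)
    have h2 : 1 < q 0 := Nat.one_lt_pow (by omega) (by norm_num)
    omega
  have hqtop : Tendsto (fun n => (q n : ℝ)) atTop atTop :=
    tendsto_natCast_atTop_atTop.comp hqmono.tendsto_atTop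
  set τ : ℝ := 1 + ∑' i, (1 / 2 : ℝ) ^ m i with hτ
  have hlow : ∀ n, 1 / (q (n + 1) : ℝ) ≤ τ - p n / q n := fun n => by
    have := (dyadic_tail_bounds m hmono (n + 1)).1
    rw [← hp n, ← hqr]
    linarith
  have hup : ∀ n, τ - p n / q n ≤ 2 / (q (n + 1) : ℝ) := fun n => by
    have := (dyadic_tail_bounds m hmono (n + 1)).2
    rw [← hp n, ← mul_one_div 2 (q (n + 1) : ℝ), ← hqr]
    linarith
  have hexp : ∀ n, (q (n + 1) : ℝ) ≤ Real.exp (a₀ * q n) := fun n => by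
    have := (hm n).2.1
    simpa [hq] using this
  have hexp' : ∀ n, |τ - p n / q n| < 4 * Real.exp (-(a₀ * q n)) := fun n => by
    have h1 : Real.exp (a₀ * q n) < 2 * q (n + 1) := by
      have := (hm n).2.2
      simpa [hq] using this
    have h0 : 0 < 1 / (q (n + 1) : ℝ) := by
      have := hq0' (n + 1)
      positivity
    rw [abs_of_pos (h0.trans_le (hlow n)), Real.exp_neg, ← div_eq_mul_inv]
    refine (hup n).trans_lt ?_
    rw [div_lt_div_iff₀ (hq0' _) (Real.exp_pos _)]
    linarith
  refine ⟨τ, ?_, ?_, ?_, ?_, ?_⟩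
  · have hL : Liouville τ := by
      intro N
      have ht : Tendsto (fun x : ℝ => x ^ (N : ℝ) * Real.exp (-a₀ * x)) atTop (nhds 0) :=
        tendsto_rpow_mul_exp_neg_mul_atTop_nhds_zero N a₀ ha₀
      obtain ⟨n, hn⟩ := ((ht.comp hqtop).eventually
        (gt_mem_nhds (by norm_num : (0 : ℝ) < 1 / 4))).exists
      simp only [Function.comp_apply, Real.rpow_natCast, neg_mul] at hn
      have h0 : 0 < 1 / (q (n + 1) : ℝ) := by
        have := hq0' (n + 1)
        positivity
      refine ⟨p n, q n, by exact_mod_cast hq1 n, ?_, ?_⟩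
      · intro h
        have := hlow n
        rw [h] at this
        simp only [Int.cast_natCast, sub_self] at this
        linarith
      · rw [Int.cast_natCast]
        refine (hexp' n).trans ?_
        have := pow_pos (hq0' n) N
        rw [lt_div_iff₀ this]
        linarith
    have hZ := hL.transcendental
    exact fun h => hZ ((IsFractionRing.isAlgebraic_iff ℤ ℚ ℝ).2 h)
  · have h1 := (dyadic_tail_bounds m hmono 0).1
    have h2 : (0 : ℝ) < (1 / 2 : ℝ) ^ m 0 := by positivity
    simp only [Finset.sum_range_zero, add_zero] at h1
    linarith
  · have h1 := (dyadic_tail_bounds m hmono 0).2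
    have h2 : (1 / 2 : ℝ) ^ m 0 ≤ (1 / 2 : ℝ) ^ (ν + 2) :=
      pow_le_pow_of_le_one (by norm_num) (by norm_num) hm0
    have h3 : (0 : ℝ) < (1 / 2 : ℝ) ^ ν := by positivity
    rw [pow_add] at h2
    simp only [Finset.sum_range_zero, add_zero] at h1
    linarith
  · refine hasApproxJ_of_approximants ha₀ p q hq0 (fun n => ?_) (fun n => ?_) hexp hlow hup
    · have h2 : IsCoprime (p n) (2 : ℤ) := by
        obtain ⟨r, hr⟩ := hodd n
        exact ⟨1, -r, by rw [hr]; ring⟩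
      simpa [hq] using h2.pow_right (n := m n)
    · have h1 : 2 ^ (2 * m n + 4) ≤ q (n + 1) := Nat.pow_le_pow_right (by norm_num) (hm n).1
      have h2 : 16 * q n ^ 2 = 2 ^ (2 * m n + 4) := by
        simp only [hq]
        ring
      omega
  · rintro a - haa ⟨C, hC, h⟩
    have ht : Tendsto (fun x : ℝ => x ^ (1 : ℝ) * Real.exp (-(a₀ - a) * x)) atTop (nhds 0) :=
      tendsto_rpow_mul_exp_neg_mul_atTop_nhds_zero 1 (a₀ - a) (by linarith)
    obtain ⟨n, hn⟩ := ((ht.comp hqtop).eventually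
      (gt_mem_nhds (by positivity : (0 : ℝ) < C / 4))).exists
    simp only [Function.comp_apply, Real.rpow_one] at hn
    have h1 := (h (p n) (q n) (hq0 n)).trans_lt (hexp' n)
    have hqn := hq0' n
    have hsplit : Real.exp (-(a₀ * q n)) =
        Real.exp (-(a₀ - a) * q n) * Real.exp (-a * q n) := by
      rw [← Real.exp_add]
      congr 1
      ring
    rw [hsplit, ← mul_assoc] at h1
    have h2 := lt_of_mul_lt_mul_right h1 (Real.exp_pos _).le
    rw [← div_eq_mul_inv, div_lt_iff₀ hqn] at h2
    linarith
end
end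

section
/- Let a₀ > 0 be a real number and let ν be a positive integer. Then there exists a transcendental real number τ with 1 < τ < 1 + 2^{−ν} such that τ has approximation property J_a for every a > a₀, but τ does not have approximation property J_{a₀}. -/
open MeasureTheory Set Filter

noncomputable section

/-- Denominators growing like `q ↦ q ^ 2 * exp (a * q)`. -/
def den (a : ℝ) (q₀ : ℕ) : ℕ → ℕ
  | 0 => q₀
  | n + 1 => den a q₀ n * (den a q₀ n * ⌈Real.exp (a * den a q₀ n)⌉₊)

/-- Numerators such that `num (n + 1) / den (n + 1) = num n / den n + 1 / den (n + 1)`. -/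
def num (a : ℝ) (q₀ : ℕ) : ℕ → ℕ
  | 0 => q₀ + 1
  | n + 1 => num a q₀ n * (den a q₀ n * ⌈Real.exp (a * den a q₀ n)⌉₊) + 1

theorem num_coprime_den (a : ℝ) (q₀ n : ℕ) : (num a q₀ n).Coprime (den a q₀ n) := by
  cases n with
  | zero => simp [num, den]
  | succ n =>
    simp only [num, den]
    set c := ⌈Real.exp (a * den a q₀ n)⌉₊
    have h : (num a q₀ n * (den a q₀ n * c) + 1).Coprime (den a q₀ n * c) := by
      simp
    exact Nat.Coprime.mul_right (Nat.Coprime.coprime_mul_right_right h) h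

theorem den_pos (a : ℝ) {q₀ : ℕ} (hq : 0 < q₀) (n : ℕ) : 0 < den a q₀ n := by
  induction n with
  | zero => exact hq
  | succ n ih =>
    exact Nat.mul_pos ih (Nat.mul_pos ih (Nat.ceil_pos.2 (Real.exp_pos _)))

theorem two_mul_sq_den_le {a : ℝ} (ha : 0 < a) {q₀ : ℕ} (hq : 0 < q₀) (n : ℕ) :
    2 * den a q₀ n ^ 2 ≤ den a q₀ (n + 1) := by
  have h0 := den_pos a hq n
  have h1 : 1 < ⌈Real.exp (a * den a q₀ n)⌉₊ := by
    rw [Nat.lt_ceil]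
    simp only [Nat.cast_one, Real.one_lt_exp_iff]
    positivity
  simp only [den]
  have := Nat.mul_le_mul_left (den a q₀ n ^ 2) h1
  nlinarith

theorem sq_mul_exp_le_den (a : ℝ) (q₀ n : ℕ) :
    (den a q₀ n : ℝ) ^ 2 * Real.exp (a * den a q₀ n) ≤ den a q₀ (n + 1) := by
  simp only [den, Nat.cast_mul]
  rw [← mul_assoc, ← sq]
  gcongr
  exact Nat.le_ceil _

theorem den_le_sq_mul_exp {a : ℝ} (ha : 0 < a) (q₀ n : ℕ) :
    (den a q₀ (n + 1) : ℝ) ≤ 2 * ((den a q₀ n : ℝ) ^ 2 * Real.exp (a * den a q₀ n)) := by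
  have h1 : (1 : ℝ) ≤ Real.exp (a * den a q₀ n) := Real.one_le_exp (by positivity)
  have h2 : (⌈Real.exp (a * den a q₀ n)⌉₊ : ℝ) ≤ 2 * Real.exp (a * den a q₀ n) := by
    linarith [Nat.ceil_lt_add_one (Real.exp_pos (a * den a q₀ n)).le]
  have h3 := mul_le_mul_of_nonneg_left h2 (sq_nonneg (den a q₀ n : ℝ))
  simp only [den, Nat.cast_mul]
  linarith

theorem lt_den {a : ℝ} (ha : 0 < a) {q₀ : ℕ} (hq : 0 < q₀) (n : ℕ) : n < den a q₀ n := by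
  induction n with
  | zero => exact hq
  | succ n ih => nlinarith [two_mul_sq_den_le ha hq n, den_pos a hq n]

theorem num_div_den_succ (a : ℝ) {q₀ : ℕ} (hq : 0 < q₀) (n : ℕ) :
    (num a q₀ (n + 1) : ℝ) / den a q₀ (n + 1) =
      num a q₀ n / den a q₀ n + 1 / den a q₀ (n + 1) := by
  have h0 := den_pos a hq n
  have h1 := den_pos a hq (n + 1)
  simp only [num, den] at h1 ⊢
  have h2 := Nat.pos_of_mul_pos_left h1
  set c := ⌈Real.exp (a * den a q₀ n)⌉₊
  have hc : c ≠ 0 := by rintro h; simp [h] at h1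
  have h0' : den a q₀ n ≠ 0 := h0.ne'
  push_cast
  field_simp

/-- The limit of `num n / den n`, with two-sided bounds on the speed of convergence. -/
theorem exists_limit_num_div_den {a : ℝ} (ha : 0 < a) {q₀ : ℕ} (hq : 0 < q₀) :
    ∃ τ : ℝ, ∀ n, 1 / (den a q₀ (n + 1) : ℝ) ≤ τ - num a q₀ n / den a q₀ n ∧
      τ - num a q₀ n / den a q₀ n ≤ 2 / (den a q₀ (n + 1) : ℝ) := by
  set x : ℕ → ℝ := fun n => (num a q₀ n : ℝ) / den a q₀ n with hx
  set y : ℕ → ℝ := fun n => x n + 2 / (den a q₀ (n + 1) : ℝ) with hy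
  have hpos : ∀ n, (0 : ℝ) < den a q₀ n := fun n => by exact_mod_cast den_pos a hq n
  have hsucc : ∀ n, x (n + 1) = x n + 1 / den a q₀ (n + 1) := num_div_den_succ a hq
  have hmono : Monotone x := monotone_nat_of_le_succ fun n => by
    rw [hsucc]
    have := hpos (n + 1)
    simp
  have hanti : Antitone y := antitone_nat_of_succ_le fun n => by
    have h1 : 2 / (den a q₀ (n + 2) : ℝ) ≤ 1 / den a q₀ (n + 1) := by
      rw [div_le_div_iff₀ (hpos _) (hpos _), one_mul]
      have h2 := two_mul_sq_den_le ha hq (n + 1)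
      have h3 := den_pos a hq (n + 1)
      have h4 : 2 * den a q₀ (n + 1) ≤ den a q₀ (n + 2) := by nlinarith
      exact_mod_cast h4
    have h5 : 2 / (den a q₀ (n + 1) : ℝ) = 1 / den a q₀ (n + 1) + 1 / den a q₀ (n + 1) := by
      ring
    simp only [hy, hsucc]
    linarith
  have hxy : ∀ n, x n ≤ y n := fun n => by
    have := hpos (n + 1)
    simp only [hy]
    have : 0 ≤ 2 / (den a q₀ (n + 1) : ℝ) := by positivity
    linarith
  have hmem := mem_iInter.1 (hmono.ciSup_mem_iInter_Icc_of_antitone hanti hxy)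
  refine ⟨⨆ n, x n, fun n => ⟨?_, ?_⟩⟩
  · have h1 := (hmem (n + 1)).1
    rw [hsucc] at h1
    linarith
  · have h2 := (hmem n).2
    simp only [hy] at h2
    linarith

theorem liouville_of_bounds {a : ℝ} (ha : 0 < a) {q₀ : ℕ} (hq : 0 < q₀) {τ : ℝ}
    (hτ : ∀ n, 1 / (den a q₀ (n + 1) : ℝ) ≤ τ - num a q₀ n / den a q₀ n ∧
      τ - num a q₀ n / den a q₀ n ≤ 2 / (den a q₀ (n + 1) : ℝ)) : Liouville τ := by
  intro N
  have hpos : ∀ n, (0 : ℝ) < den a q₀ n := fun n => by exact_mod_cast den_pos a hq n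
  have hden : Tendsto (fun n => (den a q₀ n : ℝ)) atTop atTop :=
    tendsto_atTop_mono (fun n => by exact_mod_cast (lt_den ha hq n).le)
      tendsto_natCast_atTop_atTop
  have hexp : Tendsto (fun n => Real.exp (a * den a q₀ n) / (a * den a q₀ n) ^ N) atTop atTop :=
    (Real.tendsto_exp_div_pow_atTop N).comp (hden.const_mul_atTop ha)
  obtain ⟨n, hn1, hn2⟩ := ((hexp.eventually_gt_atTop ((a ^ N)⁻¹)).and
    (eventually_ge_atTop 2)).exists
  have hq2 : 2 < den a q₀ n := lt_of_le_of_lt hn2 (lt_den ha hq n)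
  have hq2' : (2 : ℝ) < den a q₀ n := by exact_mod_cast hq2
  have hlow := (hτ n).1
  have hupp := (hτ n).2
  have hp : 0 < 1 / (den a q₀ (n + 1) : ℝ) := one_div_pos.2 (hpos _)
  refine ⟨num a q₀ n, den a q₀ n, by exact_mod_cast (by omega : 1 < den a q₀ n), ?_, ?_⟩
  · push_cast
    intro h
    rw [h] at hlow
    linarith
  · push_cast
    rw [abs_of_pos (by linarith)]
    refine hupp.trans_lt ?_
    have h1 : (den a q₀ n : ℝ) ^ N < Real.exp (a * den a q₀ n) := by
      have hqN := hpos n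
      rw [mul_pow, lt_div_iff₀ (by positivity), inv_mul_cancel_left₀ (by positivity)] at hn1
      exact hn1
    rw [div_lt_div_iff₀ (hpos _) (pow_pos (hpos n) N), one_mul]
    refine lt_of_lt_of_le ?_ (sq_mul_exp_le_den a q₀ n)
    have h2 : (2 : ℝ) ≤ (den a q₀ n : ℝ) ^ 2 := by nlinarith
    have h3 := mul_le_mul_of_nonneg_right h2 (Real.exp_pos (a * den a q₀ n)).le
    linarith

theorem lower_bound {a : ℝ} (ha : 0 < a) {q₀ : ℕ} (hq : 0 < q₀) {τ : ℝ}
    (hτ : ∀ n, 1 / (den a q₀ (n + 1) : ℝ) ≤ τ - num a q₀ n / den a q₀ n ∧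
      τ - num a q₀ n / den a q₀ n ≤ 2 / (den a q₀ (n + 1) : ℝ))
    (k : ℤ) {j : ℕ} (hj : 0 < j) :
    1 / (32 * q₀ * (j : ℝ) ^ 3 * Real.exp (a * j)) ≤ |τ - k / j| := by
  have hposN := den_pos a hq
  have hpos : ∀ n, (0 : ℝ) < den a q₀ n := fun n => by exact_mod_cast hposN n
  have hex : ∃ n, 4 * j * den a q₀ n ≤ den a q₀ (n + 1) :=
    ⟨4 * j, by nlinarith [lt_den ha hq (4 * j), two_mul_sq_den_le ha hq (4 * j)]⟩
  classical
  set n := Nat.find hex with hn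
  have hspec : 4 * j * den a q₀ n ≤ den a q₀ (n + 1) := Nat.find_spec hex
  have hspecR : 4 * (j : ℝ) * den a q₀ n ≤ den a q₀ (n + 1) := by exact_mod_cast hspec
  have hjR : (1 : ℝ) ≤ j := by exact_mod_cast hj
  have hj0 : (0 : ℝ) < j := by linarith
  have hq1 : (1 : ℝ) ≤ q₀ := by exact_mod_cast hq
  have hE : 1 ≤ Real.exp (a * j) := Real.one_le_exp (by positivity)
  by_cases heq : k * den a q₀ n = num a q₀ n * j
  · have hdvd : den a q₀ n ∣ j := by
      have h1 : (den a q₀ n : ℤ) ∣ (num a q₀ n * j : ℕ) := ⟨k, by push_cast; linarith⟩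
      exact (num_coprime_den a q₀ n).symm.dvd_of_dvd_mul_left (Int.natCast_dvd_natCast.1 h1)
    have hle : (den a q₀ n : ℝ) ≤ j := by exact_mod_cast Nat.le_of_dvd hj hdvd
    have hkj : (k : ℝ) / j = num a q₀ n / den a q₀ n := by
      rw [div_eq_div_iff hj0.ne' (hpos n).ne']
      exact_mod_cast heq
    rw [hkj]
    refine le_trans ?_ ((hτ n).1.trans (le_abs_self _))
    refine one_div_le_one_div_of_le (hpos _) ((den_le_sq_mul_exp ha q₀ n).trans ?_)
    have h2 : (den a q₀ n : ℝ) ^ 2 * Real.exp (a * den a q₀ n) ≤ j ^ 2 * Real.exp (a * j) := by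
      gcongr
    have h3 : 2 * (j : ℝ) ^ 2 ≤ 32 * q₀ * (j : ℝ) ^ 3 := by
      nlinarith [pow_pos hj0 2, mul_le_mul hq1 hjR zero_le_one (by linarith)]
    calc _ ≤ 2 * (j : ℝ) ^ 2 * Real.exp (a * j) := by linarith
      _ ≤ _ := by gcongr
  · have hdiff : 1 / ((j : ℝ) * den a q₀ n) ≤ |(num a q₀ n : ℝ) / den a q₀ n - k / j| := by
      have h1 : (1 : ℝ) ≤ |(num a q₀ n * j - k * den a q₀ n : ℝ)| := by
        have : 1 ≤ |(num a q₀ n * j - k * den a q₀ n : ℤ)| :=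
          Int.one_le_abs (sub_ne_zero.2 (Ne.symm heq))
        exact_mod_cast this
      rw [div_sub_div _ _ (hpos n).ne' hj0.ne', abs_div, abs_of_pos (mul_pos (hpos n) hj0),
        mul_comm (j : ℝ)]
      rw [mul_comm (den a q₀ n : ℝ) (k : ℝ)]
      have := mul_pos (hpos n) hj0
      gcongr
    have htail : |τ - num a q₀ n / den a q₀ n| ≤ 1 / (2 * ((j : ℝ) * den a q₀ n)) := by
      have h0 := (hτ n).1
      have hp : 0 < 1 / (den a q₀ (n + 1) : ℝ) := one_div_pos.2 (hpos _)
      rw [abs_of_pos (by linarith)]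
      refine (hτ n).2.trans ?_
      have := hpos n
      rw [div_le_div_iff₀ (hpos _) (by positivity)]
      linarith
    have htri : |(num a q₀ n : ℝ) / den a q₀ n - k / j| ≤
        |τ - num a q₀ n / den a q₀ n| + |τ - k / j| := by
      rw [abs_sub_comm τ]
      exact abs_sub_le _ _ _
    have hhalf : 1 / ((j : ℝ) * den a q₀ n) =
        1 / (2 * ((j : ℝ) * den a q₀ n)) + 1 / (2 * ((j : ℝ) * den a q₀ n)) := by
      have := hpos n
      field_simp
      norm_num
    have hmain : 1 / (2 * ((j : ℝ) * den a q₀ n)) ≤ |τ - k / j| := by linarith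
    refine le_trans ?_ hmain
    have := hpos n
    refine one_div_le_one_div_of_le (by positivity) ?_
    have hden : (den a q₀ n : ℝ) ≤ 16 * q₀ * j ^ 2 := by
      rcases Nat.eq_zero_or_eq_succ_pred n with h0 | h0
      · rw [h0]
        simp only [den]
        nlinarith [mul_le_mul hjR hjR zero_le_one hj0.le]
      · set m := n.pred
        have hm : den a q₀ (m + 1) < 4 * j * den a q₀ m :=
          not_le.1 (Nat.find_min hex (show m < Nat.find hex by omega))
        have hm2 := two_mul_sq_den_le ha hq m
        have hm3 : den a q₀ m ≤ 4 * j := by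
          have := hposN m
          by_contra! h
          nlinarith
        rw [show n = m + 1 from h0]
        have h4 : den a q₀ (m + 1) ≤ 16 * j ^ 2 := by nlinarith
        have h5 : 16 * j ^ 2 ≤ 16 * q₀ * j ^ 2 := by nlinarith [sq_nonneg j]
        exact_mod_cast h4.trans h5
    calc 2 * ((j : ℝ) * den a q₀ n) ≤ 2 * (j * (16 * q₀ * j ^ 2)) := by gcongr
      _ = 32 * q₀ * (j : ℝ) ^ 3 * 1 := by ring
      _ ≤ _ := by gcongr

theorem hasApproxJ_of_cubic_bound {τ a b c : ℝ} (hab : a < b) (hc : 0 < c)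
    (h : ∀ (k : ℤ) (j : ℕ), 0 < j → 1 / (c * (j : ℝ) ^ 3 * Real.exp (a * j)) ≤ |τ - k / j|) :
    HasApproxJ τ b := by
  have hd : 0 < b - a := sub_pos.2 hab
  refine ⟨(b - a) ^ 2 / (2 * c), by positivity, fun k j hj => le_trans ?_ (h k j hj)⟩
  have hj0 : (0 : ℝ) < j := by exact_mod_cast hj
  have h1 := Real.quadratic_le_exp_of_nonneg (x := (b - a) * j) (by positivity)
  have h2 : ((b - a) * j) ^ 2 / 2 ≤ Real.exp ((b - a) * j) := by
    have : 0 < (b - a) * j := by positivity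
    linarith
  have h3 : Real.exp (-b * j) = 1 / (Real.exp (a * j) * Real.exp ((b - a) * j)) := by
    rw [← Real.exp_add, one_div, ← Real.exp_neg]
    ring_nf
  have hE := Real.exp_pos (a * j)
  have hF := Real.exp_pos ((b - a) * j)
  rw [h3]
  calc (b - a) ^ 2 / (2 * c) * (j : ℝ)⁻¹ * (1 / (Real.exp (a * j) * Real.exp ((b - a) * j)))
      = ((b - a) * j) ^ 2 / 2 /
          (Real.exp ((b - a) * j) * (c * (j : ℝ) ^ 3 * Real.exp (a * j))) := by
        field_simp
    _ ≤ Real.exp ((b - a) * j) /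
          (Real.exp ((b - a) * j) * (c * (j : ℝ) ^ 3 * Real.exp (a * j))) := by gcongr
    _ = _ := by field_simp

theorem not_hasApproxJ_of_bounds {a : ℝ} (ha : 0 < a) {q₀ : ℕ} (hq : 0 < q₀) {τ : ℝ}
    (hτ : ∀ n, 1 / (den a q₀ (n + 1) : ℝ) ≤ τ - num a q₀ n / den a q₀ n ∧
      τ - num a q₀ n / den a q₀ n ≤ 2 / (den a q₀ (n + 1) : ℝ)) : ¬ HasApproxJ τ a := by
  rintro ⟨C, hC, h⟩
  obtain ⟨n, hn⟩ := exists_nat_gt (2 / C)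
  have hpos : ∀ n, (0 : ℝ) < den a q₀ n := fun n => by exact_mod_cast den_pos a hq n
  have hp : 0 < 1 / (den a q₀ (n + 1) : ℝ) := one_div_pos.2 (hpos _)
  have hb := h (num a q₀ n) (den a q₀ n) (den_pos a hq n)
  have hq' := hpos n
  have hE := Real.exp_pos (a * den a q₀ n)
  push_cast at hb
  rw [abs_of_pos (by linarith [(hτ n).1]), neg_mul, Real.exp_neg] at hb
  have h1 : C * (den a q₀ n : ℝ)⁻¹ * (Real.exp (a * den a q₀ n))⁻¹ ≤
      2 / ((den a q₀ n : ℝ) ^ 2 * Real.exp (a * den a q₀ n)) :=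
    (hb.trans (hτ n).2).trans
      (div_le_div_of_nonneg_left zero_le_two (by positivity) (sq_mul_exp_le_den a q₀ n))
  rw [le_div_iff₀ (by positivity)] at h1
  have h2 : C * (den a q₀ n : ℝ)⁻¹ * (Real.exp (a * den a q₀ n))⁻¹ *
      ((den a q₀ n : ℝ) ^ 2 * Real.exp (a * den a q₀ n)) = den a q₀ n * C := by
    field_simp
  rw [h2] at h1
  rw [div_lt_iff₀ hC] at hn
  have h3 : (n : ℝ) < den a q₀ n := by exact_mod_cast lt_den ha hq n
  nlinarith

theorem stmt17 (a₀ : ℝ) (ha₀ : 0 < a₀) (ν : ℕ) (hν : 0 < ν) :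
    ∃ τ : ℝ, Transcendental ℚ τ ∧ 1 < τ ∧ τ < 1 + (1 / 2 : ℝ) ^ ν ∧
      (∀ a : ℝ, a₀ < a → HasApproxJ τ a) ∧ ¬ HasApproxJ τ a₀ := by
  have hq : 0 < 2 ^ (ν + 1) := by positivity
  obtain ⟨τ, hτ⟩ := exists_limit_num_div_den ha₀ hq
  have hpos : ∀ n, (0 : ℝ) < den a₀ (2 ^ (ν + 1)) n := fun n => by
    exact_mod_cast den_pos a₀ hq n
  have hp : 0 < 1 / (den a₀ (2 ^ (ν + 1)) 1 : ℝ) := one_div_pos.2 (hpos _)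
  have h0 : (num a₀ (2 ^ (ν + 1)) 0 : ℝ) / den a₀ (2 ^ (ν + 1)) 0 = 1 + 1 / 2 ^ (ν + 1) := by
    simp only [num, den]
    push_cast
    field_simp
  obtain ⟨hlow, hupp⟩ := hτ 0
  rw [h0] at hlow hupp
  have hpow : (0 : ℝ) < 1 / 2 ^ (ν + 1) := by positivity
  refine ⟨τ, ?_, by linarith, ?_, fun a ha => ?_, not_hasApproxJ_of_bounds ha₀ hq hτ⟩
  · have hL := (liouville_of_bounds ha₀ hq hτ).transcendental
    rwa [Transcendental, ← IsFractionRing.isAlgebraic_iff ℤ ℚ ℝ]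
  · have h1 : (1 / 2 : ℝ) ^ ν = 1 / 2 ^ (ν + 1) + 1 / 2 ^ (ν + 1) := by
      rw [pow_succ, div_pow, one_pow]
      field_simp
      norm_num
    have h2 : 2 / (den a₀ (2 ^ (ν + 1)) 1 : ℝ) < 1 / 2 ^ (ν + 1) := by
      rw [div_lt_div_iff₀ (hpos _) (by positivity), one_mul]
      have h3 := two_mul_sq_den_le ha₀ hq 0
      simp only [zero_add] at h3
      rw [show den a₀ (2 ^ (ν + 1)) 0 = 2 ^ (ν + 1) from rfl] at h3
      have h4 : 2 ≤ 2 ^ (ν + 1) := Nat.le_self_pow (by omega) 2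
      have h5 : 2 * 2 ^ (ν + 1) < den a₀ (2 ^ (ν + 1)) 1 := by nlinarith
      exact_mod_cast h5
    norm_num at hupp h2 h1 ⊢
    linarith
  · have hlb := fun (k : ℤ) (j : ℕ) (hj : 0 < j) => lower_bound ha₀ hq hτ k hj
    exact hasApproxJ_of_cubic_bound ha (by positivity) hlb
end
end

section
/- Let ν be a positive integer. Then there exists a transcendental real number τ with 1 < τ < 1 + 2^{−ν} such that τ has approximation property J_a for every real number a > 0. -/
open MeasureTheory Set Filter

noncomputable section

theorem Irrational.exists_pos_le_abs_sub_div {x : ℝ} (hx : Irrational x) (N : ℕ) :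
    ∃ C > (0 : ℝ), ∀ (k : ℤ) (j : ℕ), 0 < j → j < N → C ≤ |x - k / j| := by
  induction N with
  | zero => exact ⟨1, one_pos, fun k j _ h => absurd h (Nat.not_lt_zero j)⟩
  | succ N ih =>
    obtain ⟨C, hC, h⟩ := ih
    rcases Nat.eq_zero_or_pos N with rfl | hN
    · exact ⟨C, hC, fun k j h0 h1 => by omega⟩
    have hN' : (0 : ℝ) < N := Nat.cast_pos.2 hN
    have hpos : 0 < |x * N - round (x * N)| :=
      abs_pos.2 (sub_ne_zero.2 ((hx.mul_natCast hN.ne').ne_int _))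
    refine ⟨min C (|x * N - round (x * N)| / N), lt_min hC (by positivity), fun k j h0 h1 => ?_⟩
    rcases Nat.lt_succ_iff_lt_or_eq.1 h1 with h1 | rfl
    · exact (min_le_left _ _).trans (h k j h0 h1)
    · refine (min_le_right _ _).trans ?_
      have e : x - k / j = (x * j - k) / j := by field_simp
      rw [e, abs_div, abs_of_pos hN']
      exact div_le_div_of_nonneg_right (round_le (x * j) k) hN'.le

theorem hasApproxJ_of_not_liouvilleWith {x a : ℝ} (hx : Irrational x)
    (hL : ¬ LiouvilleWith 3 x) (ha : 0 < a) : HasApproxJ x a := by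
  have hev : ∀ᶠ n : ℕ in atTop, ∀ m : ℤ, 1 / (n : ℝ) ^ (3 : ℝ) ≤ |x - m / n| := by
    by_contra hcon
    refine hL ⟨1, (not_eventually.1 hcon).mono fun n hn => ?_⟩
    push Not at hn
    obtain ⟨m, hm⟩ := hn
    refine ⟨m, fun hxm => hx ⟨(m : ℚ) / n, ?_⟩, hm⟩
    rw [hxm]
    push_cast
    rfl
  obtain ⟨N, hN⟩ := eventually_atTop.1 hev
  obtain ⟨C, hC, h⟩ := hx.exists_pos_le_abs_sub_div N
  refine ⟨min C (a ^ 2 / 2), lt_min hC (by positivity), fun k j hj => ?_⟩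
  have hj1 : (1 : ℝ) ≤ j := by exact_mod_cast hj
  have hj0 : (0 : ℝ) < j := by linarith
  rcases lt_or_ge j N with hjN | hjN
  · refine le_trans ?_ (h k j hj hjN)
    have h1 : (j : ℝ)⁻¹ ≤ 1 := inv_le_one_of_one_le₀ hj1
    have h2 : Real.exp (-a * j) ≤ 1 := Real.exp_le_one_iff.2 (by nlinarith)
    calc min C (a ^ 2 / 2) * (j : ℝ)⁻¹ * Real.exp (-a * j) ≤ C * 1 * 1 := by
          gcongr
          exact min_le_left _ _
      _ = C := by ring
  · refine le_trans ?_ (hN j hjN k)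
    have h1 : (a * j) ^ 2 / 2 ≤ Real.exp (a * j) := by
      have := Real.quadratic_le_exp_of_nonneg (x := a * j) (by positivity)
      nlinarith [mul_pos ha hj0]
    calc min C (a ^ 2 / 2) * (j : ℝ)⁻¹ * Real.exp (-a * j)
        ≤ a ^ 2 / 2 * (j : ℝ)⁻¹ * Real.exp (-a * j) := by
          gcongr
          exact min_le_right _ _
      _ = (a * j) ^ 2 / 2 * Real.exp (-a * j) / (j : ℝ) ^ 3 := by field_simp
      _ ≤ Real.exp (a * j) * Real.exp (-a * j) / (j : ℝ) ^ 3 := by gcongr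
      _ = 1 / (j : ℝ) ^ (3 : ℝ) := by
          rw [← Real.exp_add, show a * j + -a * j = 0 by ring, Real.exp_zero]
          norm_cast

theorem stmt18 (ν : ℕ) (hν : 0 < ν) :
    ∃ τ : ℝ, Transcendental ℚ τ ∧ 1 < τ ∧ τ < 1 + (1 / 2 : ℝ) ^ ν ∧
      ∀ a : ℝ, 0 < a → HasApproxJ τ a := by
  have hT : ∀ᵐ x : ℝ, Transcendental ℚ x := by
    have hcount : {x : ℝ | IsAlgebraic ℚ x}.Countable := Algebraic.countable ℚ ℝ
    filter_upwards [hcount.ae_notMem volume] with x hx using hx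
  have hvol : (volume (Ioo (1 : ℝ) (1 + (1 / 2) ^ ν))) ≠ 0 := by
    rw [Real.volume_Ioo]
    simp
  obtain ⟨τ, hτ, hI⟩ : ∃ x : ℝ, (Transcendental ℚ x ∧ ∀ p > (2 : ℝ), ¬ LiouvilleWith p x) ∧
      x ∈ Ioo (1 : ℝ) (1 + (1 / 2) ^ ν) := by
    by_contra! hcon
    exact hvol (measure_mono_null (fun x hx h => hcon x h hx)
      (ae_iff.1 (hT.and ae_not_liouvilleWith)))
  exact ⟨τ, hτ.1, hI.1, hI.2, fun a ha =>
    hasApproxJ_of_not_liouvilleWith hτ.1.irrational (hτ.2 3 (by norm_num)) ha⟩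
end
end

section
/- Let ν be a positive integer. Then there exists a transcendental real number τ with 1 < τ < 1 + 2^{−ν} such that τ has approximation property J_a for no real number a > 0. -/
open MeasureTheory Set Filter

noncomputable section

/-- A generic real number lies within any prescribed positive distance `r j`, depending on the
denominator `j`, of some fraction `k / j`. -/
theorem eventually_residual_exists_abs_sub_div_lt (r : ℕ → ℝ) (hr : ∀ j, 0 < j → 0 < r j) :
    ∀ᶠ x : ℝ in residual ℝ, ∃ (k : ℤ) (j : ℕ), 0 < j ∧ |x - k / j| < r j := by
  refine residual_of_dense_open (s := {x : ℝ | ∃ (k : ℤ) (j : ℕ), 0 < j ∧ |x - k / j| < r j})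
    ?_ ?_
  · simp only [ofPred_exists, ofPred_and]
    refine isOpen_iUnion fun k => isOpen_iUnion fun j => isOpen_const.inter ?_
    exact isOpen_lt (by fun_prop) continuous_const
  · refine Rat.denseRange_cast.mono ?_
    rintro _ ⟨q, rfl⟩
    refine ⟨q.num, q.den, q.den_pos, ?_⟩
    rw [← Rat.cast_def, sub_self, abs_zero]
    exact hr _ q.den_pos

/-- A generic real number has the approximation property `J_a` for no `a`. -/
theorem eventually_residual_forall_not_hasApproxJ :
    ∀ᶠ x : ℝ in residual ℝ, ∀ a : ℝ, ¬ HasApproxJ x a := by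
  have h : ∀ᶠ x : ℝ in residual ℝ, ∀ n : ℕ, ∃ (k : ℤ) (j : ℕ), 0 < j ∧
      |x - k / j| < 1 / ((n : ℝ) + 1) * (j : ℝ)⁻¹ * Real.exp (-n * j) := by
    refine eventually_countable_forall.2 fun n =>
      eventually_residual_exists_abs_sub_div_lt _ fun j hj => ?_
    have : (0 : ℝ) < j := Nat.cast_pos.2 hj
    positivity
  filter_upwards [h] with x hx a
  rintro ⟨C, hC, hx'⟩
  obtain ⟨m, hm⟩ := exists_nat_one_div_lt hC
  obtain ⟨l, hl⟩ := exists_nat_ge a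
  obtain ⟨k, j, hj, hlt⟩ := hx (max m l)
  refine absurd (hx' k j hj) (not_le.2 (hlt.trans_le ?_))
  have hm' : (m : ℝ) ≤ (max m l : ℕ) := by exact_mod_cast le_max_left m l
  have hl' : (l : ℝ) ≤ (max m l : ℕ) := by exact_mod_cast le_max_right m l
  have hCle : 1 / (((max m l : ℕ) : ℝ) + 1) ≤ C :=
    (one_div_le_one_div_of_le (by positivity) (by linarith)).trans hm.le
  gcongr
  exact hl.trans hl'

theorem stmt19 (ν : ℕ) (hν : 0 < ν) :
    ∃ τ : ℝ, Transcendental ℚ τ ∧ 1 < τ ∧ τ < 1 + (1 / 2 : ℝ) ^ ν ∧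
      ∀ a : ℝ, 0 < a → ¬ HasApproxJ τ a := by
  have hdense : Dense {x : ℝ | Liouville x ∧ ∀ a : ℝ, ¬ HasApproxJ x a} :=
    dense_of_mem_residual
      (eventually_residual_liouville.and eventually_residual_forall_not_hasApproxJ)
  obtain ⟨τ, ⟨hL, hJ⟩, h1, h2⟩ := hdense.exists_between
    (show (1 : ℝ) < 1 + (1 / 2 : ℝ) ^ ν from lt_add_of_pos_right 1 (by positivity))
  exact ⟨τ, fun h => hL.transcendental ((IsFractionRing.isAlgebraic_iff ℤ ℚ ℝ).2 h), h1, h2,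
    fun a _ => hJ a⟩
end
end
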